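/- arXiv:2603.22071 — 6 statements merged into one kernel-verified Lean document; each statement's English description precedes it below -/
import Mathlib

section
/- Let X_1, …, X_n be fixed distinct design points in a set M and let ε_1, …, ε_n be i.i.d. standard Gaussian random variables. Let 𝒜 be a family of subsets of M with finite VC dimension VCD(𝒜). Then there exists a universal constant C > 0 such that for every λ > 0, the probability that max_{A ∈ 𝒜} | (1/√(|A|_D)) Σ_{i : X_i ∈ A} ε_i | ≥ λ is at most C · n^{VCD(𝒜)} · e^{−λ²/2}, with the convention that (1/√(|A|_D)) Σ_{i : X_i ∈ A} ε_i = 0 when |A|_D = 0. -/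
open MeasureTheory ProbabilityTheory
open scoped symmDiff ENNReal NNReal

attribute [local instance] Classical.propDecidable

/-- Number of design points falling in `A`, i.e. `|A|_D`. -/
noncomputable def cnt {M : Type*} {n : ℕ} (X : Fin n → M) (A : Set M) : ℕ :=
  (Finset.univ.filter fun i => X i ∈ A).card

/-- Sum of the entries of `Z` over indices whose design point lies in `A`. -/
noncomputable def sumIn {M : Type*} {n : ℕ} (X : Fin n → M) (A : Set M) (Z : Fin n → ℝ) : ℝ :=
  ∑ i ∈ Finset.univ.filter (fun i => X i ∈ A), Z i

/-- The CUSUM statistic `T_A(Z)`, with the convention that it is `0` when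
`|A|_D = 0` or `|A^c|_D = 0`. -/
noncomputable def cusum {M : Type*} {n : ℕ} (X : Fin n → M) (A : Set M) (Z : Fin n → ℝ) : ℝ :=
  if cnt X A = 0 ∨ cnt X Aᶜ = 0 then 0
  else Real.sqrt ((cnt X A : ℝ) * (cnt X Aᶜ : ℝ) / (n : ℝ)) *
    (sumIn X A Z / (cnt X A : ℝ) - sumIn X Aᶜ Z / (cnt X Aᶜ : ℝ))

/-- The in-sample loss `L_n(A, B) = (1/n) * min(|A △ B|_D, |A △ B^c|_D)`. -/
noncomputable def lossN {M : Type*} {n : ℕ} (X : Fin n → M) (A B : Set M) : ℝ :=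
  (1 / (n : ℝ)) * min ((cnt X (A ∆ B) : ℝ)) ((cnt X (A ∆ Bᶜ) : ℝ))

/-- A family `𝒜` of subsets of `Ω` shatters a finite set `S ⊆ Ω` if
`{S ∩ A : A ∈ 𝒜}` is the whole power set of `S`. -/
def Shatters {Ω : Type*} (𝒜 : Set (Set Ω)) (S : Finset Ω) : Prop :=
  ∀ T : Finset Ω, T ⊆ S → ∃ A ∈ 𝒜, (S : Set Ω) ∩ A = (T : Set Ω)

/-- The VC dimension of a family of sets: the supremum of the cardinalities of
finite shattered subsets, as an extended natural number. -/
noncomputable def VCD {Ω : Type*} (𝒜 : Set (Set Ω)) : ℕ∞ :=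
  ⨆ S ∈ {S : Finset Ω | Shatters 𝒜 S}, (S.card : ℕ∞)

/-- The standardised sum `(1/√|A|_D) Σ_{i : X_i ∈ A} ε_i`, equal to `0` when `|A|_D = 0`. -/
noncomputable def stdSum {M : Type*} {n : ℕ} (X : Fin n → M) (A : Set M) (ε : Fin n → ℝ) : ℝ :=
  if cnt X A = 0 then 0 else sumIn X A ε / Real.sqrt (cnt X A : ℝ)

lemma aux_subG (n : ℕ) (i : Fin n) :
    HasSubgaussianMGF (fun ω : Fin n → ℝ => ω i) 1
      (Measure.pi fun _ : Fin n => gaussianReal 0 1) := by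
  have h : HasSubgaussianMGF (id : ℝ → ℝ) 1 (gaussianReal 0 1) := by
    refine ⟨fun t => integrable_exp_mul_gaussianReal t, fun t => ?_⟩
    rw [mgf_id_gaussianReal]
    simp
  have hm := measurePreserving_eval (fun _ : Fin n => gaussianReal 0 1) i
  rw [← hm.map_eq] at h
  exact h.of_map hm.measurable.aemeasurable

lemma aux_tail (n : ℕ) (s : Finset (Fin n)) (hs : s.Nonempty) (lam : ℝ) (hl : 0 < lam) :
    (Measure.pi fun _ : Fin n => gaussianReal 0 1)
      {ε : Fin n → ℝ | lam ≤ |(∑ i ∈ s, ε i) / Real.sqrt (s.card : ℝ)|} ≤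
      ENNReal.ofReal (2 * Real.exp (-lam ^ 2 / 2)) := by
  set μ := (Measure.pi fun _ : Fin n => gaussianReal 0 1) with hμ
  have hc : (0 : ℝ) < s.card := by exact_mod_cast hs.card_pos
  have hsq : 0 < Real.sqrt (s.card : ℝ) := Real.sqrt_pos.2 hc
  have hind : iIndepFun (fun (i : Fin n) (ω : Fin n → ℝ) => ω i) μ :=
    iIndepFun_pi (X := fun _ => id) (fun _ => aemeasurable_id)
  have hsum := HasSubgaussianMGF.sum_of_iIndepFun hind (c := fun _ => 1) (s := s)
    (fun i _ => aux_subG n i)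
  have hnn : 0 ≤ lam * Real.sqrt (s.card : ℝ) := by positivity
  have h1 := hsum.measure_ge_le hnn
  have h2 := hsum.neg.measure_ge_le hnn
  have he : -(lam * Real.sqrt (s.card : ℝ)) ^ 2 / (2 * ((∑ i ∈ s, (1 : ℝ≥0) : ℝ≥0) : ℝ))
      = -lam ^ 2 / 2 := by
    simp only [Finset.sum_const, nsmul_eq_mul, mul_one, NNReal.coe_natCast]
    rw [mul_pow, Real.sq_sqrt hc.le]
    field_simp
  rw [he] at h1 h2
  have hsub : {ε : Fin n → ℝ | lam ≤ |(∑ i ∈ s, ε i) / Real.sqrt (s.card : ℝ)|} ⊆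
      {ω | lam * Real.sqrt (s.card : ℝ) ≤ ∑ i ∈ s, ω i} ∪
      {ω | lam * Real.sqrt (s.card : ℝ) ≤ (-fun ω : Fin n → ℝ => ∑ i ∈ s, ω i) ω} := by
    intro ω hω
    simp only [Set.mem_ofPred_eq, abs_div, abs_of_pos hsq, le_div_iff₀ hsq] at hω
    rcases le_abs.1 hω with h | h
    · exact Or.inl h
    · exact Or.inr h
  have h3 := (measureReal_mono (μ := μ) hsub).trans (measureReal_union_le _ _)
  rw [← ENNReal.ofReal_toReal (measure_ne_top μ _)]
  apply ENNReal.ofReal_le_ofReal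
  change μ.real _ ≤ _
  linarith

lemma aux_sauer {n : ℕ} (hn : 1 ≤ n) (F : Finset (Finset (Fin n))) (v : ℕ)
    (hF : F.vcDim ≤ v) : (F.card : ℝ) ≤ Real.exp 1 * (n : ℝ) ^ v := by
  have h1 := F.card_le_card_shatterer.trans Finset.card_shatterer_le_sum_vcDim
  have hn' : (1 : ℝ) ≤ n := by exact_mod_cast hn
  calc (F.card : ℝ) ≤ ((∑ k ∈ Finset.Iic F.vcDim, (Fintype.card (Fin n)).choose k : ℕ) : ℝ) := by
        exact_mod_cast h1
    _ = ∑ k ∈ Finset.Iic F.vcDim, (n.choose k : ℝ) := by push_cast; simp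
    _ ≤ ∑ k ∈ Finset.Iic F.vcDim, (n : ℝ) ^ v * ((1 : ℝ) ^ k / (k.factorial : ℝ)) := by
        refine Finset.sum_le_sum fun k hk => ?_
        refine (Nat.choose_le_pow_div k n).trans ?_
        rw [one_pow, mul_one_div]
        gcongr
        exact (Finset.mem_Iic.1 hk).trans hF
    _ = (n : ℝ) ^ v * ∑ k ∈ Finset.range (F.vcDim + 1), ((1 : ℝ) ^ k / (k.factorial : ℝ)) := by
        rw [← Finset.mul_sum]
        congr 2
        ext k
        simp
    _ ≤ (n : ℝ) ^ v * Real.exp 1 := by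
        gcongr
        exact Real.sum_le_exp_of_nonneg zero_le_one _
    _ = _ := mul_comm _ _

lemma aux_vc {M : Type} {n : ℕ} (X : Fin n → M) (hX : Function.Injective X)
    (𝒜 : Set (Set M)) (v : ℕ) (hv : VCD 𝒜 = (v : ℕ∞)) (F : Finset (Finset (Fin n)))
    (hF : ∀ s ∈ F, ∃ A ∈ 𝒜, ∀ i, i ∈ s ↔ X i ∈ A) : F.vcDim ≤ v := by
  unfold Finset.vcDim
  refine Finset.sup_le fun s hs => ?_
  rw [Finset.mem_shatterer] at hs
  have hsh : Shatters 𝒜 (s.map ⟨X, hX⟩) := by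
    intro T hT
    obtain ⟨u, hu, hsu⟩ := hs (t := s.filter fun i => X i ∈ T) (Finset.filter_subset _ _)
    obtain ⟨A, hA, hAu⟩ := hF u hu
    refine ⟨A, hA, ?_⟩
    ext x
    simp only [Finset.coe_map, Function.Embedding.coeFn_mk, Set.mem_inter_iff, Set.mem_image,
      Finset.mem_coe]
    constructor
    · rintro ⟨⟨i, hi, rfl⟩, hx⟩
      have : i ∈ s.filter fun i => X i ∈ T := by
        rw [← hsu]
        exact Finset.mem_inter.2 ⟨hi, (hAu i).2 hx⟩
      exact (Finset.mem_filter.1 this).2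
    · intro hx
      obtain ⟨i, hi, rfl⟩ := Finset.mem_map.1 (hT hx)
      refine ⟨⟨i, hi, rfl⟩, ?_⟩
      have : i ∈ s.filter fun i => X i ∈ T := Finset.mem_filter.2 ⟨hi, hx⟩
      rw [← hsu] at this
      exact (hAu i).1 (Finset.mem_inter.1 this).2
  have hle : ((s.map ⟨X, hX⟩).card : ℕ∞) ≤ VCD 𝒜 :=
    le_iSup₂_of_le (f := fun (S : Finset M) (_ : S ∈ {S : Finset M | Shatters 𝒜 S}) =>
      (S.card : ℕ∞)) (s.map ⟨X, hX⟩) hsh le_rfl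
  rw [hv, Finset.card_map] at hle
  exact_mod_cast hle

/-- Proposition: a uniform Gaussian tail bound, over a VC class `𝒜`, for the standardised
sums of i.i.d. standard Gaussian noise over the sets of `𝒜`. -/
theorem statement0 :
    ∃ C : ℝ, 0 < C ∧
      ∀ (M : Type) (n : ℕ) (X : Fin n → M), Function.Injective X →
        ∀ (𝒜 : Set (Set M)) (v : ℕ), VCD 𝒜 = (v : ℕ∞) →
          ∀ lam : ℝ, 0 < lam →
            (Measure.pi fun _ : Fin n => gaussianReal 0 1)
                {ε : Fin n → ℝ | ∃ A ∈ 𝒜, lam ≤ |stdSum X A ε|} ≤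
              ENNReal.ofReal (C * (n : ℝ) ^ v * Real.exp (-lam ^ 2 / 2)) := by
  refine ⟨2 * Real.exp 1, by positivity, ?_⟩
  intro M n X hX 𝒜 v hv lam hl
  rcases Nat.eq_zero_or_pos n with rfl | hn
  · have : {ε : Fin 0 → ℝ | ∃ A ∈ 𝒜, lam ≤ |stdSum X A ε|} = ∅ := by
      ext ε
      simp [stdSum, cnt, hl]
    rw [this]
    simp
  set μ := (Measure.pi fun _ : Fin n => gaussianReal 0 1) with hμ
  set F : Finset (Finset (Fin n)) :=
    Finset.univ.filter fun s => ∃ A ∈ 𝒜, ∀ i, i ∈ s ↔ X i ∈ A with hFdef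
  have hF : F.vcDim ≤ v := aux_vc X hX 𝒜 v hv F (fun s hs => (Finset.mem_filter.1 hs).2)
  have hcard := aux_sauer hn F v hF
  set G := F.filter fun s => s.Nonempty with hG
  have hGF : (G.card : ℝ) ≤ F.card := by exact_mod_cast Finset.card_filter_le _ _
  have hsub : {ε : Fin n → ℝ | ∃ A ∈ 𝒜, lam ≤ |stdSum X A ε|} ⊆
      ⋃ s ∈ G, {ε : Fin n → ℝ | lam ≤ |(∑ i ∈ s, ε i) / Real.sqrt (s.card : ℝ)|} := by
    rintro ε ⟨A, hA, h⟩
    unfold stdSum at h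
    split_ifs at h with h0
    · simp at h
      linarith
    · simp only [Set.mem_iUnion]
      refine ⟨Finset.univ.filter fun i => X i ∈ A, ?_, h⟩
      refine Finset.mem_filter.2 ⟨Finset.mem_filter.2 ⟨Finset.mem_univ _, A, hA, by simp⟩, ?_⟩
      exact Finset.card_pos.1 (Nat.pos_of_ne_zero h0)
  calc μ _ ≤ μ (⋃ s ∈ G, {ε : Fin n → ℝ | lam ≤ |(∑ i ∈ s, ε i) / Real.sqrt (s.card : ℝ)|}) :=
        measure_mono hsub
    _ ≤ ∑ s ∈ G, μ {ε : Fin n → ℝ | lam ≤ |(∑ i ∈ s, ε i) / Real.sqrt (s.card : ℝ)|} :=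
        measure_biUnion_finset_le _ _
    _ ≤ ∑ s ∈ G, ENNReal.ofReal (2 * Real.exp (-lam ^ 2 / 2)) :=
        Finset.sum_le_sum fun s hs => aux_tail n s (Finset.mem_filter.1 hs).2 lam hl
    _ = ENNReal.ofReal (G.card * (2 * Real.exp (-lam ^ 2 / 2))) := by
        rw [Finset.sum_const, nsmul_eq_mul, ENNReal.ofReal_mul (p := (G.card : ℝ)) (by positivity),
          ENNReal.ofReal_natCast]
    _ ≤ _ := by
        apply ENNReal.ofReal_le_ofReal
        have := Real.exp_pos (-lam ^ 2 / 2)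
        calc (G.card : ℝ) * (2 * Real.exp (-lam ^ 2 / 2))
            ≤ (Real.exp 1 * (n : ℝ) ^ v) * (2 * Real.exp (-lam ^ 2 / 2)) := by
              gcongr
              exact hGF.trans hcard
          _ = _ := by ring
end

section
/- Let X_1, …, X_n be fixed distinct design points in a set M and let ε_1, …, ε_n be i.i.d. standard Gaussian random variables. Let 𝒜 be a family of subsets of M with finite VC dimension VCD(𝒜). Then there exists a universal constant C > 0 such that for every λ > 0, the probability that max_{A ∈ 𝒜} |T_A(ε)| ≥ λ is at most C · n^{VCD(𝒜)} · e^{−λ²/2}. -/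
open MeasureTheory ProbabilityTheory
open scoped symmDiff ENNReal NNReal

attribute [local instance] Classical.propDecidable

noncomputable def tr {M : Type*} {n : ℕ} (X : Fin n → M) (A : Set M) : Finset (Fin n) :=
  Finset.univ.filter fun i => X i ∈ A

lemma tr_compl {M : Type*} {n : ℕ} (X : Fin n → M) (A : Set M) : tr X Aᶜ = (tr X A)ᶜ := by
  ext i; simp [tr]

lemma cusum_congr {M : Type*} {n : ℕ} (X : Fin n → M) (A B : Set M) (h : tr X A = tr X B)
    (Z : Fin n → ℝ) : cusum X A Z = cusum X B Z := by
  have h' : tr X Aᶜ = tr X Bᶜ := by rw [tr_compl, tr_compl, h]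
  have e1 : cnt X A = cnt X B := congrArg Finset.card h
  have e2 : cnt X Aᶜ = cnt X Bᶜ := congrArg Finset.card h'
  have e3 : sumIn X A Z = sumIn X B Z := congrArg (fun s => ∑ i ∈ s, Z i) h
  have e4 : sumIn X Aᶜ Z = sumIn X Bᶜ Z := congrArg (fun s => ∑ i ∈ s, Z i) h'
  unfold cusum
  rw [e1, e2, e3, e4]

lemma subG_linear {n : ℕ} (w : Fin n → ℝ) (hw : ∑ i, w i ^ 2 = 1) :
    HasSubgaussianMGF (fun ε : Fin n → ℝ => ∑ i, w i * ε i) 1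
      (Measure.pi fun _ : Fin n => gaussianReal 0 1) := by
  have hind : iIndepFun (fun (i : Fin n) (ε : Fin n → ℝ) => w i * ε i)
      (Measure.pi fun _ : Fin n => gaussianReal 0 1) :=
    iIndepFun_pi (X := fun i x => w i * x) (fun i => by fun_prop)
  have h0 : HasSubgaussianMGF (id : ℝ → ℝ) 1 (gaussianReal 0 1) :=
    ⟨fun t => integrable_exp_mul_gaussianReal t, fun t => by rw [mgf_id_gaussianReal]; simp⟩
  have hc : ∀ i ∈ (Finset.univ : Finset (Fin n)),
      HasSubgaussianMGF (fun ε : Fin n → ℝ => w i * ε i) (Real.toNNReal (w i ^ 2))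
      (Measure.pi fun _ : Fin n => gaussianReal 0 1) := by
    intro i _
    have h1 : HasSubgaussianMGF (id ∘ fun ε : Fin n → ℝ => ε i) 1
        (Measure.pi fun _ : Fin n => gaussianReal 0 1) := by
      apply HasSubgaussianMGF.of_map (measurable_pi_apply i).aemeasurable
      have := (measurePreserving_eval (fun _ : Fin n => gaussianReal 0 1) i).map_eq
      rw [show (fun ε : Fin n → ℝ => ε i) = Function.eval i from rfl, this]
      exact h0
    have h2 := h1.const_mul (w i)
    have e : (w i ^ 2).toNNReal = NNReal.mk (w i ^ 2) (sq_nonneg (w i)) * 1 := (Real.toNNReal_of_nonneg (sq_nonneg _)).trans (mul_one _).symm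
    rw [e]
    exact h2
  have := HasSubgaussianMGF.sum_of_iIndepFun hind hc
  convert this using 1
  rw [← Real.toNNReal_sum_of_nonneg (fun i _ => sq_nonneg _), hw, Real.toNNReal_one]

lemma tail_linear {n : ℕ} (w : Fin n → ℝ) (hw : ∑ i, w i ^ 2 = 1) (lam : ℝ) (hl : 0 < lam) :
    (Measure.pi fun _ : Fin n => gaussianReal 0 1)
      {ε : Fin n → ℝ | lam ≤ |∑ i, w i * ε i|} ≤ ENNReal.ofReal (2 * Real.exp (-lam ^ 2 / 2)) := by
  have h := subG_linear w hw
  have h1 := h.measure_ge_le hl.le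
  have h2 := h.neg.measure_ge_le hl.le
  have e : {ε : Fin n → ℝ | lam ≤ |∑ i, w i * ε i|} =
    {ε | lam ≤ ∑ i, w i * ε i} ∪ {ε | lam ≤ (-fun ε : Fin n → ℝ => ∑ i, w i * ε i) ε} := by
    ext ε; simp [le_abs]
  rw [e, ← ofReal_measureReal]
  apply ENNReal.ofReal_le_ofReal
  refine (measureReal_union_le _ _).trans ?_
  simp only [NNReal.coe_one, mul_one] at h1 h2
  linarith

lemma tail_cusum {M : Type*} {n : ℕ} (X : Fin n → M) (A : Set M) (lam : ℝ) (hl : 0 < lam) :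
    (Measure.pi fun _ : Fin n => gaussianReal 0 1)
      {ε : Fin n → ℝ | lam ≤ |cusum X A ε|} ≤ ENNReal.ofReal (2 * Real.exp (-lam ^ 2 / 2)) := by
  by_cases hd : cnt X A = 0 ∨ cnt X Aᶜ = 0
  · have : {ε : Fin n → ℝ | lam ≤ |cusum X A ε|} = ∅ := by
      ext ε; simp [cusum, hd, hl]
    rw [this]; simp
  · have hd' := hd
    push Not at hd'
    obtain ⟨ha, hb⟩ := hd'
    have hcard : cnt X A + cnt X Aᶜ = n := by
      have := Finset.card_add_card_compl (tr X A)
      rw [← tr_compl] at this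
      rw [Fintype.card_fin] at this
      exact this
    have ha' : (0:ℝ) < cnt X A := by positivity
    have hb' : (0:ℝ) < cnt X Aᶜ := by positivity
    have hn : (cnt X A : ℝ) + cnt X Aᶜ = n := by exact_mod_cast hcard
    set a : ℝ := (cnt X A : ℝ) with hadef
    set b : ℝ := (cnt X Aᶜ : ℝ) with hbdef
    have split : ∀ f g : Fin n → ℝ, ∑ i, (if X i ∈ A then f i else g i) =
        (∑ i ∈ tr X A, f i) + ∑ i ∈ tr X Aᶜ, g i := by
      intro f g
      rw [Finset.sum_ite]
      congr 1
      refine Finset.sum_congr ?_ (fun _ _ => rfl)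
      ext i; simp [tr]
    have hnp : (0:ℝ) < n := by linarith
    set q := Real.sqrt (a * b / n) with hq
    have hq2 : q ^ 2 = a * b / n := Real.sq_sqrt (by positivity)
    have key := tail_linear (fun i => if X i ∈ A then q / a else - (q / b)) ?_ lam hl
    · convert key using 5 with ε
      simp only [cusum, if_neg hd, ite_mul]
      rw [split]
      simp only [sumIn, tr, ← Finset.mul_sum, ← hadef, ← hbdef, ← hq]
      congr 1
      ring
    · simp only [ite_pow]
      rw [split]
      simp only [Finset.sum_const, nsmul_eq_mul]
      change a * _ + b * _ = _
      rw [neg_sq, div_pow, div_pow, hq2]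
      field_simp
      linarith

lemma card_family {M : Type*} {n : ℕ} (hn : 0 < n) (X : Fin n → M) (hX : Function.Injective X)
    (𝒜 : Set (Set M)) (v : ℕ) (hv : VCD 𝒜 = (v : ℕ∞)) (F : Finset (Finset (Fin n)))
    (hF : ∀ s ∈ F, ∃ A ∈ 𝒜, tr X A = s) :
    (F.card : ℝ) ≤ Real.exp 1 * (n : ℝ) ^ v := by
  have hvc : F.vcDim ≤ v := by
    unfold Finset.vcDim
    apply Finset.sup_le
    intro S hS
    rw [Finset.mem_shatterer] at hS
    have hsh : Shatters 𝒜 (S.map ⟨X, hX⟩) := by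
      intro T hT
      obtain ⟨T', hT', rfl⟩ := Finset.subset_map_iff.1 hT
      obtain ⟨u, hu, hSu⟩ := hS hT'
      obtain ⟨A, hA, rfl⟩ := hF u hu
      refine ⟨A, hA, ?_⟩
      rw [← hSu]
      ext x
      simp only [tr, Finset.coe_map, Set.mem_inter_iff, Set.mem_image, Finset.mem_coe,
        Finset.mem_inter, Finset.mem_filter, Finset.mem_univ, true_and, Function.Embedding.coeFn_mk]
      constructor
      · rintro ⟨⟨i, hi, rfl⟩, hx⟩
        exact ⟨i, ⟨hi, hx⟩, rfl⟩
      · rintro ⟨i, ⟨hi, hx⟩, rfl⟩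
        exact ⟨⟨i, hi, rfl⟩, hx⟩
    have : ((S.map ⟨X, hX⟩).card : ℕ∞) ≤ VCD 𝒜 :=
      le_iSup₂ (f := fun (S : Finset M) (_ : S ∈ {S : Finset M | Shatters 𝒜 S}) => (S.card : ℕ∞))
        (S.map ⟨X, hX⟩) hsh
    rw [hv, Finset.card_map] at this
    exact_mod_cast this
  have h1 : F.card ≤ ∑ k ∈ Finset.range (v + 1), n.choose k := by
    refine (F.card_le_card_shatterer.trans F.card_shatterer_le_sum_vcDim).trans ?_
    rw [Fintype.card_fin]
    apply Finset.sum_le_sum_of_subset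
    intro k hk
    simp at hk ⊢
    omega
  have hn1 : (1:ℝ) ≤ n := by exact_mod_cast hn
  calc (F.card : ℝ) ≤ ∑ k ∈ Finset.range (v + 1), (n.choose k : ℝ) := by exact_mod_cast h1
    _ ≤ ∑ k ∈ Finset.range (v + 1), (1 ^ k / (k.factorial : ℝ)) * (n : ℝ) ^ v := by
      apply Finset.sum_le_sum
      intro k hk
      refine (Nat.choose_le_pow_div k n).trans ?_
      rw [one_pow, div_mul_eq_mul_div, one_mul]
      gcongr
      simp at hk; omega
    _ ≤ _ := by
      rw [← Finset.sum_mul]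
      gcongr
      exact Real.sum_le_exp_of_nonneg zero_le_one _

/-- Proposition: a uniform Gaussian tail bound, over a VC class `𝒜`, for the CUSUM
statistics of i.i.d. standard Gaussian noise. -/
theorem statement1 :
    ∃ C : ℝ, 0 < C ∧
      ∀ (M : Type) (n : ℕ) (X : Fin n → M), Function.Injective X →
        ∀ (𝒜 : Set (Set M)) (v : ℕ), VCD 𝒜 = (v : ℕ∞) →
          ∀ lam : ℝ, 0 < lam →
            (Measure.pi fun _ : Fin n => gaussianReal 0 1)
                {ε : Fin n → ℝ | ∃ A ∈ 𝒜, lam ≤ |cusum X A ε|} ≤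
              ENNReal.ofReal (C * (n : ℝ) ^ v * Real.exp (-lam ^ 2 / 2)) := by
  refine ⟨2 * Real.exp 1, by positivity, ?_⟩
  intro M n X hX 𝒜 v hv lam hl
  rcases Nat.eq_zero_or_pos n with rfl | hn
  · have : {ε : Fin 0 → ℝ | ∃ A ∈ 𝒜, lam ≤ |cusum X A ε|} = ∅ := by
      ext ε; simp [cusum, cnt, hl]
    rw [this]; simp
  · let F : Finset (Finset (Fin n)) := Finset.univ.filter fun s => ∃ A ∈ 𝒜, tr X A = s
    have hF : ∀ s ∈ F, ∃ A ∈ 𝒜, tr X A = s := fun s hs => (Finset.mem_filter.1 hs).2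
    choose! B hB hBt using hF
    have hsub : {ε : Fin n → ℝ | ∃ A ∈ 𝒜, lam ≤ |cusum X A ε|} ⊆
        ⋃ s ∈ F, {ε : Fin n → ℝ | lam ≤ |cusum X (B s) ε|} := by
      rintro ε ⟨A, hA, h⟩
      have hm : tr X A ∈ F := Finset.mem_filter.2 ⟨Finset.mem_univ _, A, hA, rfl⟩
      refine Set.mem_iUnion₂.2 ⟨tr X A, hm, ?_⟩
      change lam ≤ _
      rwa [cusum_congr X _ A (hBt _ hm)]
    refine (measure_mono hsub).trans ((measure_biUnion_finset_le _ _).trans ?_)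
    refine (Finset.sum_le_sum fun s _ => tail_cusum X (B s) lam hl).trans ?_
    rw [Finset.sum_const, nsmul_eq_mul, ← ENNReal.ofReal_natCast,
      ← ENNReal.ofReal_mul (by positivity)]
    apply ENNReal.ofReal_le_ofReal
    have := card_family hn X hX 𝒜 v hv F fun s hs => (Finset.mem_filter.1 hs).2
    calc (F.card : ℝ) * (2 * Real.exp (-lam ^ 2 / 2))
        ≤ (Real.exp 1 * (n : ℝ) ^ v) * (2 * Real.exp (-lam ^ 2 / 2)) := by gcongr
      _ = _ := by ring
end

section
/- Fix d ≥ 2, σ > 0, θ > 0 and n ≥ 1 with d·σ²/(n·θ²) ≤ 1. For each disc R ∈ 𝒮, let P_R denote the joint law of (X_1,Y_1), …, (X_n,Y_n), where X_1,…,X_n are i.i.d. uniform on S^{d−1} (normalized surface measure P_X) and, conditionally on the design, Y_i = θ·1{X_i ∈ R} + ε_i with ε_1,…,ε_n i.i.d. N(0,σ²). Then there exists a universal constant C > 0 such that inf over all measurable estimators R̂ (measurable maps from ((S^{d−1}) × ℝ)^n to S^{d−1} × [0,1], identified with the disc A_{α̂,β̂}) of sup over R ∈ 𝒮 of E_{P_R}[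 L(R̂, R) ] is at least C · d · σ² / (n · θ²), where L(A, B) := min( P_X(A △ B), P_X(A △ B^c) ). -/
open MeasureTheory ProbabilityTheory
open scoped symmDiff ENNReal NNReal RealInnerProductSpace

/-- The unit sphere `S^{d-1}` in `ℝ^d`. -/
abbrev Sph (d : ℕ) : Set (EuclideanSpace ℝ (Fin d)) :=
  Metric.sphere (0 : EuclideanSpace ℝ (Fin d)) 1

/-- The spherical disc `A_{α,β} = {x ∈ S^{d-1} : ⟨x, α⟩ ≥ β}`. -/
def disc {d : ℕ} (α : Sph d) (β : ℝ) : Set (Sph d) :=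
  {x : Sph d | β ≤ ⟪(x : EuclideanSpace ℝ (Fin d)), (α : EuclideanSpace ℝ (Fin d))⟫}

/-- The uniform (normalised surface) probability measure `P_X` on the unit sphere. -/
noncomputable def unifSph (d : ℕ) : Measure (Sph d) :=
  ((volume : Measure (EuclideanSpace ℝ (Fin d))).toSphere Set.univ)⁻¹ •
    (volume : Measure (EuclideanSpace ℝ (Fin d))).toSphere

/-- The population loss `L(A, B) = min(P_X(A △ B), P_X(A △ B^c))`. -/
noncomputable def popLoss (d : ℕ) (A B : Set (Sph d)) : ℝ :=
  min (unifSph d (A ∆ B)).toReal (unifSph d (A ∆ Bᶜ)).toReal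

/-- The joint law `P_R` of `(X_1, Y_1), …, (X_n, Y_n)` where `X_i` are i.i.d. uniform on the
sphere and `Y_i = θ·1{X_i ∈ R} + ε_i` with `ε_i` i.i.d. `N(0, σ²)` independent of the design. -/
noncomputable def jointLaw (d n : ℕ) (σ θ : ℝ) (R : Set (Sph d)) :
    Measure (Fin n → Sph d × ℝ) :=
  Measure.map
    (fun ω i => ((ω i).1, θ * Set.indicator R (fun _ => (1 : ℝ)) (ω i).1 + (ω i).2))
    (Measure.pi fun _ : Fin n =>
      (unifSph d).prod (gaussianReal 0 ⟨σ ^ 2, sq_nonneg σ⟩))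

/-- wedge -/
def Wd {d : ℕ} (u w : EuclideanSpace ℝ (Fin d)) : Set (EuclideanSpace ℝ (Fin d)) :=
  {y | (0 ≤ ⟪y, u⟫ ∧ ¬ 0 ≤ ⟪y, w⟫) ∨ (0 ≤ ⟪y, w⟫ ∧ ¬ 0 ≤ ⟪y, u⟫)}

/-- normalised wedge volume -/
noncomputable def Dd {d : ℕ} (u w : EuclideanSpace ℝ (Fin d)) : ℝ :=
  ((volume : Measure (EuclideanSpace ℝ (Fin d))).real (Metric.ball 0 1))⁻¹ *
    (volume : Measure (EuclideanSpace ℝ (Fin d))).real (Metric.ball 0 1 ∩ Wd u w)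

lemma measurableSet_Wd {d : ℕ} (u w : EuclideanSpace ℝ (Fin d)) : MeasurableSet (Wd u w) := by
  have h : ∀ v : EuclideanSpace ℝ (Fin d), MeasurableSet {y : EuclideanSpace ℝ (Fin d) | 0 ≤ ⟪y, v⟫} :=
    fun v => measurableSet_le measurable_const (by fun_prop)
  exact ((h u).inter (h w).compl).union ((h w).inter (h u).compl)

lemma measurableSet_disc {d : ℕ} (α : Sph d) (β : ℝ) : MeasurableSet (disc α β) := by
  unfold disc
  exact measurableSet_le measurable_const (by fun_prop)

lemma ball_real_pos (d : ℕ) :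
    0 < (volume : Measure (EuclideanSpace ℝ (Fin d))).real (Metric.ball 0 1) := by
  apply ENNReal.toReal_pos
  · exact (Metric.measure_ball_pos _ _ one_pos).ne'
  · exact measure_ball_lt_top.ne

instance unifSph_prob (d : ℕ) [NeZero d] : IsProbabilityMeasure (unifSph d) := by
  constructor
  have hd : 0 < d := Nat.pos_of_ne_zero (NeZero.ne d)
  have : Nonempty (Fin d) := ⟨⟨0, hd⟩⟩
  have : Nontrivial (EuclideanSpace ℝ (Fin d)) := by
    infer_instance
  unfold unifSph
  rw [Measure.smul_apply, smul_eq_mul]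
  apply ENNReal.inv_mul_cancel
  · rw [ne_eq, Measure.measure_univ_eq_zero]
    exact Measure.toSphere_ne_zero _
  · exact measure_ne_top _ _

open scoped Pointwise in
lemma unif_disc {d : ℕ} [NeZero d] (α β : Sph d) :
    (unifSph d (disc α 0 ∆ disc β 0)).toReal = Dd (α : EuclideanSpace ℝ (Fin d)) β := by
  have hd : d ≠ 0 := NeZero.ne d
  unfold unifSph
  rw [Measure.smul_apply, smul_eq_mul, Measure.toSphere_apply_univ,
    Measure.toSphere_apply' _ ((measurableSet_disc α 0).symmDiff (measurableSet_disc β 0))]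
  have hset : Set.Ioo (0:ℝ) 1 • ((fun x : Sph d => (x : EuclideanSpace ℝ (Fin d))) '' (disc α 0 ∆ disc β 0))
      = Metric.ball 0 1 ∩ Wd (α : EuclideanSpace ℝ (Fin d)) β := by
    ext y
    constructor
    · rintro ⟨r, hr, _, ⟨x, hx, rfl⟩, rfl⟩
      refine ⟨?_, ?_⟩
      · have := x.2
        simp only [mem_sphere_iff_norm, sub_zero] at this
        simp [norm_smul, this, abs_of_pos hr.1, hr.2]
      · simp only [Wd, Set.mem_ofPred_eq, inner_smul_left, RCLike.conj_to_real, mul_nonneg_iff_of_pos_left hr.1]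
        exact hx
    · rintro ⟨hy, hw⟩
      have hy0 : y ≠ 0 := by
        rintro rfl
        simp [Wd] at hw
      have hn : 0 < ‖y‖ := norm_pos_iff.2 hy0
      have hs : ‖y‖⁻¹ • y ∈ Sph d := by
        simp [norm_smul, hn.ne']
      refine ⟨‖y‖, ⟨hn, by simpa using hy⟩, ‖y‖⁻¹ • y, ⟨⟨_, hs⟩, ?_, rfl⟩, ?_⟩
      · have := hw
        simp only [Wd, Set.mem_ofPred_eq] at this
        change (_ ∧ _) ∨ (_ ∧ _)
        simp only [disc, Set.mem_ofPred_eq, inner_smul_left, RCLike.conj_to_real, mul_nonneg_iff_of_pos_left (inv_pos.2 hn)]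
        exact this
      · simp [smul_smul, hn.ne']
  rw [hset, Dd]
  have hd' : (d : ℝ) ≠ 0 := by exact_mod_cast hd
  simp only [ENNReal.toReal_mul, ENNReal.toReal_inv, finrank_euclideanSpace, Fintype.card_fin, ENNReal.toReal_natCast, Measure.real]
  field_simp

lemma Dd_comm {d : ℕ} (u w : EuclideanSpace ℝ (Fin d)) : Dd u w = Dd w u := by
  unfold Dd
  congr 2
  unfold Wd
  ext y; simp only [Set.mem_inter_iff, Set.mem_ofPred_eq]; tauto

lemma Dd_nonneg {d : ℕ} (u w : EuclideanSpace ℝ (Fin d)) : 0 ≤ Dd u w := by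
  unfold Dd; positivity

lemma Dd_le_one {d : ℕ} (u w : EuclideanSpace ℝ (Fin d)) : Dd u w ≤ 1 := by
  unfold Dd
  rw [inv_mul_le_iff₀ (ball_real_pos d), mul_one]
  exact measureReal_mono Set.inter_subset_left measure_ball_lt_top.ne

lemma Dd_isom {d : ℕ} (U : EuclideanSpace ℝ (Fin d) ≃ₗᵢ[ℝ] EuclideanSpace ℝ (Fin d))
    (u w : EuclideanSpace ℝ (Fin d)) : Dd (U u) (U w) = Dd u w := by
  unfold Dd
  congr 1
  rw [Measure.real, Measure.real, ← (U.measurePreserving).measure_preimage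
    (Metric.isOpen_ball.measurableSet.inter (measurableSet_Wd _ _)).nullMeasurableSet]
  congr 2
  ext y
  simp [Wd]

lemma Dd_add {d : ℕ} {u v w : EuclideanSpace ℝ (Fin d)} {a b : ℝ} (ha : 0 < a) (hb : 0 < b)
    (h : w = a • u + b • v) : Dd u v = Dd u w + Dd w v := by
  unfold Dd
  rw [← mul_add, ← measureReal_union _
    (Metric.isOpen_ball.measurableSet.inter (measurableSet_Wd _ _))
    (measure_ne_top_of_subset Set.inter_subset_left measure_ball_lt_top.ne)
    (measure_ne_top_of_subset Set.inter_subset_left measure_ball_lt_top.ne)]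
  · congr 2
    rw [← Set.inter_union_distrib_left]
    congr 1
    ext y
    have : ⟪y, w⟫ = a * ⟪y, u⟫ + b * ⟪y, v⟫ := by
      rw [h, inner_add_right, inner_smul_right, inner_smul_right]
    have h1 : 0 ≤ ⟪y, u⟫ → 0 ≤ ⟪y, v⟫ → 0 ≤ ⟪y, w⟫ := fun h1 h2 => by rw [this]; positivity
    have h2 : ¬ 0 ≤ ⟪y, u⟫ → ¬ 0 ≤ ⟪y, v⟫ → ¬ 0 ≤ ⟪y, w⟫ := fun h1 h2 => by
      rw [this]; push Not at *; nlinarith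
    simp only [Wd, Set.mem_union, Set.mem_ofPred_eq]
    tauto
  · rw [Set.disjoint_left]
    rintro y ⟨-, hy⟩ ⟨-, hy'⟩
    have : ⟪y, w⟫ = a * ⟪y, u⟫ + b * ⟪y, v⟫ := by
      rw [h, inner_add_right, inner_smul_right, inner_smul_right]
    have h1 : 0 ≤ ⟪y, u⟫ → 0 ≤ ⟪y, v⟫ → 0 ≤ ⟪y, w⟫ := fun h1 h2 => by rw [this]; positivity
    have h2 : ¬ 0 ≤ ⟪y, u⟫ → ¬ 0 ≤ ⟪y, v⟫ → ¬ 0 ≤ ⟪y, w⟫ := fun h1 h2 => by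
      rw [this]; push Not at *; nlinarith
    simp only [Wd, Set.mem_ofPred_eq] at hy hy'
    tauto

lemma Dd_triangle {d : ℕ} (u v w : EuclideanSpace ℝ (Fin d)) : Dd u w ≤ Dd u v + Dd v w := by
  unfold Dd
  rw [← mul_add]
  refine mul_le_mul_of_nonneg_left ?_ (by positivity)
  refine le_trans (measureReal_mono ?_ ?_) (measureReal_union_le _ _)
  · rintro y ⟨hy, hw⟩
    simp only [Wd, Set.mem_union, Set.mem_inter_iff, Set.mem_ofPred_eq] at *
    tauto
  · exact (measure_union_lt_top (measure_lt_top_of_subset Set.inter_subset_left measure_ball_lt_top.ne)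
      (measure_lt_top_of_subset Set.inter_subset_left measure_ball_lt_top.ne)).ne

lemma Dd_smul_right {d : ℕ} (u v : EuclideanSpace ℝ (Fin d)) {a : ℝ} (ha : 0 < a) :
    Dd u (a • v) = Dd u v := by
  unfold Dd Wd
  simp only [inner_smul_right, mul_nonneg_iff_of_pos_left ha]

/-- reflection exchanging two vectors of the same norm, fixing everything orthogonal to the
difference -/
lemma refl_fix {d : ℕ} {v w a : EuclideanSpace ℝ (Fin d)} (h : ⟪a, v⟫ = ⟪a, w⟫) :
    (ℝ ∙ (v - w))ᗮ.reflection a = a := by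
  apply Submodule.reflection_mem_subspace_eq_self
  rw [Submodule.mem_orthogonal_singleton_iff_inner_left, inner_sub_right, h, sub_self]

lemma Dd_congr {d : ℕ} {a b a' b' : EuclideanSpace ℝ (Fin d)} (ha : ‖a‖ = ‖a'‖) (hb : ‖b‖ = ‖b'‖)
    (h : ⟪a, b⟫ = ⟪a', b'⟫) : Dd a b = Dd a' b' := by
  set U := (ℝ ∙ (a - a'))ᗮ.reflection
  have hU : U a = a' := Submodule.reflection_sub ha
  have h1 : Dd a b = Dd a' (U b) := by rw [← hU, Dd_isom]
  have h2 : ⟪a', U b⟫ = ⟪a', b'⟫ := by rw [← h, ← hU, LinearIsometryEquiv.inner_map_map]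
  rw [h1]
  set V := (ℝ ∙ (U b - b'))ᗮ.reflection
  have hV : V (U b) = b' := Submodule.reflection_sub (by rw [LinearIsometryEquiv.norm_map, hb])
  have hV' : V a' = a' := refl_fix h2
  rw [← Dd_isom V, hV, hV']

lemma Dd_orth {d : ℕ} {a b : EuclideanSpace ℝ (Fin d)} (h : ⟪a, b⟫ = 0) (hb : b ≠ 0) :
    1 / 2 ≤ Dd a b := by
  have h1 : Dd a (-b) = Dd a b := Dd_congr rfl (norm_neg b) (by simp [h])
  have h2 : Dd (-b) b = 1 := by
    unfold Dd
    have : (volume : Measure (EuclideanSpace ℝ (Fin d))).real (Metric.ball 0 1 ∩ Wd (-b) b)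
      = (volume : Measure (EuclideanSpace ℝ (Fin d))).real (Metric.ball 0 1) := by
      rw [Measure.real, Measure.real]
      congr 1
      have hz : (volume : Measure (EuclideanSpace ℝ (Fin d))) ((ℝ ∙ b)ᗮ : Submodule ℝ (EuclideanSpace ℝ (Fin d))) = 0 := by
        apply Measure.addHaar_submodule
        intro htop
        have : b ∈ (ℝ ∙ b)ᗮ := by rw [htop]; trivial
        rw [Submodule.mem_orthogonal_singleton_iff_inner_left] at this
        exact hb (inner_self_eq_zero.1 this)
      apply le_antisymm (measure_mono Set.inter_subset_left)
      calc _ ≤ volume ((Metric.ball 0 1 ∩ Wd (-b) b) ∪ ((ℝ ∙ b)ᗮ : Submodule ℝ (EuclideanSpace ℝ (Fin d)))) := by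
            apply measure_mono
            intro y hy
            by_cases hyb : ⟪y, b⟫ = 0
            · right
              simpa [Submodule.mem_orthogonal_singleton_iff_inner_left] using hyb
            · left
              refine ⟨hy, ?_⟩
              simp only [Wd, Set.mem_ofPred_eq, inner_neg_right]
              rcases lt_or_gt_of_ne hyb with h | h
              · left; constructor <;> linarith
              · right; constructor <;> linarith
        _ ≤ _ := measure_union_le _ _
        _ = _ := by rw [hz, add_zero]
    rw [this, inv_mul_cancel₀ (ball_real_pos d).ne']
  have h3 := Dd_triangle (-b) a b
  rw [Dd_comm (-b) a] at h3
  linarith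

/-- the angular function -/
lemma Dd_half {d : ℕ} {e f : EuclideanSpace ℝ (Fin d)} (he : ‖e‖ = 1) (hf : ‖f‖ = 1)
    (hef : ⟪e, f⟫ = 0) (k : ℕ) :
    Dd e (Real.cos (Real.pi / 2 ^ (k + 1)) • e + Real.sin (Real.pi / 2 ^ (k + 1)) • f) =
      Dd e f / 2 ^ k := by
  have hee : ⟪e, e⟫ = 1 := by rw [real_inner_self_eq_norm_sq, he]; norm_num
  have hff : ⟪f, f⟫ = 1 := by rw [real_inner_self_eq_norm_sq, hf]; norm_num
  have hfe : ⟪f, e⟫ = 0 := by rw [real_inner_comm]; exact hef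
  induction k with
  | zero => simp
  | succ k ih =>
    set t := Real.pi / 2 ^ (k + 1 + 1) with ht
    have ht2 : Real.pi / 2 ^ (k + 1) = 2 * t := by rw [ht, pow_succ (n := k + 1)]; field_simp
    have htpos : 0 < t := by positivity
    have htlt : t < Real.pi / 2 := by
      rw [ht]
      apply div_lt_div_of_pos_left Real.pi_pos (by norm_num)
      calc (2 : ℝ) = 2 ^ 1 := by norm_num
        _ < 2 ^ (k + 1 + 1) := pow_lt_pow_right₀ (by norm_num) (by omega)
    have hc : 0 < Real.cos t := Real.cos_pos_of_mem_Ioo ⟨by linarith, htlt⟩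
    rw [ht2] at ih
    set v := Real.cos (2 * t) • e + Real.sin (2 * t) • f with hv
    set w := Real.cos t • e + Real.sin t • f with hw
    have hvw : w = (1 / (2 * Real.cos t)) • e + (1 / (2 * Real.cos t)) • v := by
      rw [hv, hw, Real.cos_two_mul, Real.sin_two_mul]
      simp only [smul_add, smul_smul, ← add_assoc, ← add_smul]
      congr 2
      · field_simp; ring
      · field_simp
    have hadd := Dd_add (by positivity) (by positivity) hvw
    have hsc := Real.sin_sq_add_cos_sq t
    have hsc2 := Real.sin_sq_add_cos_sq (2 * t)
    have hnv : ‖v‖ = 1 := by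
      have : ⟪v, v⟫ = 1 := by
        rw [hv]
        simp only [inner_add_left, inner_add_right, inner_smul_left, inner_smul_right, hee, hff, hef, hfe, RCLike.conj_to_real]
        linarith
      rw [real_inner_self_eq_norm_sq] at this
      nlinarith [norm_nonneg v]
    have heq : Dd w v = Dd e w := by
      rw [Dd_comm e w]
      apply Dd_congr rfl (by rw [hnv, he])
      rw [hv, hw]
      simp only [inner_add_left, inner_add_right, inner_smul_left, inner_smul_right, hee, hff, hef, hfe, RCLike.conj_to_real]
      rw [Real.cos_two_mul, Real.sin_two_mul]
      linear_combination (2 * Real.cos t) * hsc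
    rw [heq, ih] at hadd
    rw [pow_succ]
    have : Dd e f / (2 ^ k * 2) = (Dd e f / 2 ^ k) / 2 := by field_simp
    rw [this]
    linarith

lemma Dd_mono {d : ℕ} {e f b : EuclideanSpace ℝ (Fin d)} (he : ‖e‖ = 1) (hf : ‖f‖ = 1)
    (hb : ‖b‖ = 1) (hef : ⟪e, f⟫ = 0) {s : ℝ} (hs0 : 0 < s) (hs : s < Real.pi)
    (h : ⟪e, b⟫ ≤ Real.cos s) (h' : -1 < ⟪e, b⟫) :
    Dd e (Real.cos s • e + Real.sin s • f) ≤ Dd e b := by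
  have hee : ⟪e, e⟫ = 1 := by rw [real_inner_self_eq_norm_sq, he]; norm_num
  have hff : ⟪f, f⟫ = 1 := by rw [real_inner_self_eq_norm_sq, hf]; norm_num
  have hfe : ⟪f, e⟫ = 0 := by rw [real_inner_comm]; exact hef
  have hcs1 : Real.cos s < 1 := by
    rw [← Real.cos_zero]; exact Real.cos_lt_cos_of_nonneg_of_le_pi le_rfl hs.le hs0
  set t := Real.arccos ⟪e, b⟫ with ht
  have hct : Real.cos t = ⟪e, b⟫ := Real.cos_arccos h'.le (by linarith)
  have htpi : t < Real.pi := by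
    apply lt_of_le_of_ne (Real.arccos_le_pi _)
    intro h0
    rw [ht, h0, Real.cos_pi] at hct
    linarith
  have hst : s ≤ t := by
    by_contra hlt
    push Not at hlt
    have := Real.cos_lt_cos_of_nonneg_of_le_pi (Real.arccos_nonneg _) hs.le hlt
    linarith
  have hsc := Real.sin_sq_add_cos_sq t
  have hbv : Dd e b = Dd e (Real.cos t • e + Real.sin t • f) := by
    apply Dd_congr rfl
    · rw [hb]
      have : ⟪Real.cos t • e + Real.sin t • f, Real.cos t • e + Real.sin t • f⟫ = 1 := by
        simp only [inner_add_left, inner_add_right, inner_smul_left, inner_smul_right, hee, hff, hef, hfe, RCLike.conj_to_real]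
        linarith
      rw [real_inner_self_eq_norm_sq] at this
      nlinarith [norm_nonneg (Real.cos t • e + Real.sin t • f)]
    · simp only [inner_add_right, inner_smul_right, hee, hef, hct]
      ring
  rw [hbv]
  rcases hst.eq_or_lt with h0 | hlt
  · rw [h0]
  have hsint : 0 < Real.sin t := Real.sin_pos_of_pos_of_lt_pi (by linarith) htpi
  have hsins : 0 < Real.sin s := Real.sin_pos_of_pos_of_lt_pi hs0 hs
  have hsind : 0 < Real.sin (t - s) := Real.sin_pos_of_pos_of_lt_pi (by linarith) (by linarith)
  have key : Real.cos s • e + Real.sin s • f = (Real.sin (t - s) / Real.sin t) • e +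
      (Real.sin s / Real.sin t) • (Real.cos t • e + Real.sin t • f) := by
    simp only [smul_add, smul_smul, ← add_assoc, ← add_smul]
    congr 2
    · rw [Real.sin_sub]; field_simp; ring
    · field_simp
  have := Dd_add (by positivity) (by positivity) key
  linarith [Dd_nonneg (Real.cos s • e + Real.sin s • f) (Real.cos t • e + Real.sin t • f)]
lemma pi_withDensity_exp {Z : Type*} [MeasurableSpace Z] (n : ℕ) (p q : Measure Z)
    [IsProbabilityMeasure p] [IsProbabilityMeasure q] (l : Z → ℝ) (hl : Measurable l)
    (hq : q = p.withDensity (fun z => ENNReal.ofReal (Real.exp (-l z)))) :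
    Measure.pi (fun _ : Fin n => q) = (Measure.pi (fun _ : Fin n => p)).withDensity
      (fun z => ENNReal.ofReal (Real.exp (-∑ i, l (z i)))) := by
  have hint : Integrable (fun z => Real.exp (-l z)) p := by
    refine ⟨by fun_prop, ?_⟩
    rw [hasFiniteIntegral_iff_ofReal (Filter.Eventually.of_forall fun z => (Real.exp_pos _).le)]
    have : q Set.univ = 1 := measure_univ
    rw [hq, withDensity_apply _ MeasurableSet.univ, Measure.restrict_univ] at this
    rw [this]; exact ENNReal.one_lt_top
  apply Measure.pi_eq
  intro s hs
  rw [withDensity_apply _ (MeasurableSet.univ_pi hs), ← lintegral_indicator (MeasurableSet.univ_pi hs)]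
  have h1 : ∀ z : Fin n → Z, (Set.univ.pi s).indicator
      (fun z => ENNReal.ofReal (Real.exp (-∑ i, l (z i)))) z =
      ENNReal.ofReal (∏ i, (s i).indicator (fun z => Real.exp (-l z)) (z i)) := by
    intro z
    by_cases hz : z ∈ Set.univ.pi s
    · rw [Set.indicator_of_mem hz, ← Finset.sum_neg_distrib, Real.exp_sum]
      congr 1
      refine Finset.prod_congr rfl fun i _ => ?_
      rw [Set.indicator_of_mem (hz i trivial)]
    · rw [Set.indicator_of_notMem hz]
      simp only [Set.mem_univ_pi, not_forall] at hz
      obtain ⟨i, hi⟩ := hz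
      rw [Finset.prod_eq_zero (Finset.mem_univ i) (Set.indicator_of_notMem hi _), ENNReal.ofReal_zero]
  simp_rw [h1]
  have h2 : ∀ i, Integrable ((s i).indicator (fun z => Real.exp (-l z))) p :=
    fun i => hint.indicator (hs i)
  have h0 : ∀ i z, 0 ≤ (s i).indicator (fun z => Real.exp (-l z)) z :=
    fun i z => Set.indicator_nonneg (fun _ _ => (Real.exp_pos _).le) _
  rw [← ofReal_integral_eq_lintegral_ofReal (Integrable.fintype_prod (μ := fun _ => p) h2)
    (Filter.Eventually.of_forall fun z => Finset.prod_nonneg fun i _ => h0 i _),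
    integral_fintype_prod_eq_prod (fun i => (s i).indicator (fun z => Real.exp (-l z))) (μ := fun _ => p),
    ENNReal.ofReal_prod_of_nonneg (fun i _ => integral_nonneg (h0 i))]
  refine Finset.prod_congr rfl fun i _ => ?_
  rw [ofReal_integral_eq_lintegral_ofReal (h2 i) (Filter.Eventually.of_forall (h0 i)), hq,
    withDensity_apply _ (hs i), ← lintegral_indicator (hs i)]
  congr 1
  ext z
  by_cases hz : z ∈ s i
  · simp [hz]
  · simp [hz]

lemma young_pi {Z : Type*} [MeasurableSpace Z] (n : ℕ) (p q : Measure Z)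
    [IsProbabilityMeasure p] [IsProbabilityMeasure q] (l : Z → ℝ) (hl : Measurable l)
    (hli : Integrable l p)
    (hq : q = p.withDensity (fun z => ENNReal.ofReal (Real.exp (-l z))))
    (A : Set (Fin n → Z)) (hA : MeasurableSet A) (s : ℝ) :
    s * (Measure.pi (fun _ : Fin n => p)).real A ≤ n * ∫ z, l z ∂p +
      (Measure.pi (fun _ : Fin n => q)).real A * (Real.exp s - 1) := by
  have hQ := pi_withDensity_exp n p q l hl hq
  set P := Measure.pi (fun _ : Fin n => p)
  set Q := Measure.pi (fun _ : Fin n => q)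
  set L : (Fin n → Z) → ℝ := fun z => ∑ i, l (z i) with hL
  have hLm : Measurable L := by fun_prop
  set f : (Fin n → Z) → ℝ := A.indicator (fun _ => s) with hf
  have hfm : Measurable f := measurable_const.indicator hA
  have hLi : Integrable L P := integrable_finsetSum _ fun i _ =>
    integrable_comp_eval (μ := fun _ : Fin n => p) (i := i) hli
  have hLint : ∫ z, L z ∂P = n * ∫ z, l z ∂p := by
    rw [hL, integral_finsetSum _ fun i _ =>
      integrable_comp_eval (μ := fun _ : Fin n => p) (i := i) hli]
    have h1 : ∀ i : Fin n, ∫ z, l (z i) ∂P = ∫ z, l z ∂p := fun i =>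
      integral_comp_eval (μ := fun _ : Fin n => p) hl.aestronglyMeasurable
    rw [Finset.sum_congr rfl fun i _ => h1 i, Finset.sum_const, Finset.card_univ, Fintype.card_fin, nsmul_eq_mul]
  have hfi : Integrable f P := (integrable_const s).indicator hA
  have hfint : ∫ z, f z ∂P = s * P.real A := by
    rw [hf, integral_indicator_const _ hA, smul_eq_mul, mul_comm]
  have hexpf : ∀ z, Real.exp (f z) = 1 + A.indicator (fun _ => Real.exp s - 1) z := by
    intro z
    by_cases hz : z ∈ A <;> simp [hf, hz]
  have hei : Integrable (fun z => Real.exp (f z)) Q := by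
    simp_rw [hexpf]
    exact (integrable_const _).add ((integrable_const _).indicator hA)
  have heint : ∫ z, Real.exp (f z) ∂Q = 1 + Q.real A * (Real.exp s - 1) := by
    simp_rw [hexpf]
    rw [integral_add (integrable_const _) ((integrable_const _).indicator hA),
      integral_indicator_const _ hA]
    simp
  have hdm : Measurable (fun z => Real.toNNReal (Real.exp (-L z))) := by fun_prop
  have hQ' : Q = P.withDensity (fun z => ((Real.toNNReal (Real.exp (-L z)) : ℝ≥0) : ℝ≥0∞)) := hQ
  have hcomb : ∀ z, (Real.toNNReal (Real.exp (-L z))) • Real.exp (f z) = Real.exp (f z - L z) := by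
    intro z
    rw [NNReal.smul_def, Real.coe_toNNReal _ (Real.exp_pos _).le, smul_eq_mul, ← Real.exp_add]
    ring_nf
  have hei' : Integrable (fun z => Real.exp (f z - L z)) P := by
    rw [hQ', integrable_withDensity_iff_integrable_smul hdm] at hei
    simpa only [hcomb] using hei
  have heint' : ∫ z, Real.exp (f z - L z) ∂P = 1 + Q.real A * (Real.exp s - 1) := by
    rw [← heint]
    conv_rhs => rw [hQ', integral_withDensity_eq_integral_smul hdm]
    simp only [hcomb]
  have key : ∫ z, (f z - L z) ∂P ≤ ∫ z, (Real.exp (f z - L z) - 1) ∂P := by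
    apply integral_mono (hfi.sub hLi) (hei'.sub (integrable_const _))
    intro z
    have := Real.add_one_le_exp (f z - L z)
    simp only [Pi.sub_apply]
    linarith
  rw [integral_sub hfi hLi, integral_sub hei' (integrable_const _), heint', hfint, hLint] at key
  simp at key
  linarith

/-- variance -/
noncomputable def vr (σ : ℝ) : ℝ≥0 := ⟨σ ^ 2, sq_nonneg σ⟩

lemma vr_coe (σ : ℝ) : (vr σ : ℝ) = σ ^ 2 := rfl

/-- one-sample law -/
noncomputable def oneLaw (d : ℕ) (σ θ : ℝ) (R : Set (Sph d)) : Measure (Sph d × ℝ) :=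
  ((unifSph d).prod (gaussianReal 0 (vr σ))).map
    (fun z => (z.1, θ * Set.indicator R (fun _ => (1 : ℝ)) z.1 + z.2))

lemma meas_shift {d : ℕ} (θ : ℝ) {R : Set (Sph d)} (hR : MeasurableSet R) :
    Measurable (fun z : Sph d × ℝ => (z.1, θ * Set.indicator R (fun _ => (1 : ℝ)) z.1 + z.2)) := by
  have : Measurable (Set.indicator R (fun _ => (1 : ℝ))) := measurable_const.indicator hR
  fun_prop

instance oneLaw_prob (d : ℕ) [NeZero d] (σ θ : ℝ) (R : Set (Sph d)) [hR : Fact (MeasurableSet R)] :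
    IsProbabilityMeasure (oneLaw d σ θ R) := by
  unfold oneLaw
  exact Measure.isProbabilityMeasure_map (meas_shift θ hR.out).aemeasurable

lemma jointLaw_eq (d n : ℕ) [NeZero d] (σ θ : ℝ) (R : Set (Sph d)) [hR : Fact (MeasurableSet R)] :
    jointLaw d n σ θ R = Measure.pi (fun _ : Fin n => oneLaw d σ θ R) := by
  change Measure.map
    (fun ω i => ((ω i).1, θ * Set.indicator R (fun _ => (1 : ℝ)) (ω i).1 + (ω i).2))
    (Measure.pi fun _ : Fin n => (unifSph d).prod (gaussianReal 0 (vr σ))) = _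
  have : ∀ i : Fin n, SigmaFinite (((unifSph d).prod (gaussianReal 0 (vr σ))).map
    (fun z : Sph d × ℝ => (z.1, θ * Set.indicator R (fun _ => (1 : ℝ)) z.1 + z.2))) := fun i => by
    change SigmaFinite (oneLaw d σ θ R)
    infer_instance
  exact Measure.pi_map_pi (μ := fun _ : Fin n => (unifSph d).prod (gaussianReal 0 (vr σ)))
    (f := fun (_ : Fin n) (z : Sph d × ℝ) => (z.1, θ * Set.indicator R (fun _ => (1 : ℝ)) z.1 + z.2)) (hμ := this)
    (fun i => (meas_shift θ hR.out).aemeasurable)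

lemma oneLaw_lintegral (d : ℕ) [NeZero d] (σ θ : ℝ) (hσ : 0 < σ) (R : Set (Sph d))
    (hR : MeasurableSet R) (f : Sph d × ℝ → ℝ≥0∞) (hf : Measurable f) :
    ∫⁻ z, f z ∂(oneLaw d σ θ R) = ∫⁻ x, ∫⁻ y,
      gaussianPDF (θ * Set.indicator R (fun _ => (1 : ℝ)) x) (vr σ) y * f (x, y)
      ∂volume ∂(unifSph d) := by
  have hv : ((vr σ) : ℝ≥0) ≠ 0 := by
    intro h
    have := congrArg NNReal.toReal h
    rw [vr_coe] at this
    simp at this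
    exact hσ.ne' this
  unfold oneLaw
  have hfs : Measurable fun z : Sph d × ℝ => f (z.1, θ * Set.indicator R (fun _ => (1 : ℝ)) z.1 + z.2) :=
    hf.comp (meas_shift θ hR)
  rw [lintegral_map hf (meas_shift θ hR), lintegral_prod _ hfs.aemeasurable]
  congr 1
  ext x
  set c := θ * Set.indicator R (fun _ => (1 : ℝ)) x
  have : gaussianReal c (vr σ) = (gaussianReal 0 (vr σ)).map (c + ·) := by
    rw [gaussianReal_map_const_add, zero_add]
  have h2 : ∫⁻ y, f (x, y) ∂(gaussianReal c (vr σ)) =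
      ∫⁻ y, f (x, c + y) ∂(gaussianReal 0 (vr σ)) := by
    rw [this, lintegral_map (by fun_prop) (by fun_prop)]
  rw [← h2, gaussianReal_of_var_ne_zero _ hv, lintegral_withDensity_eq_lintegral_mul _
    (measurable_gaussianPDF _ _) (by fun_prop)]
  rfl

/-- log-likelihood ratio -/
noncomputable def loglr {d : ℕ} (σ θ : ℝ) (R R0 : Set (Sph d)) (z : Sph d × ℝ) : ℝ :=
  ((z.2 - θ * Set.indicator R0 (fun _ => (1 : ℝ)) z.1) ^ 2 -
    (z.2 - θ * Set.indicator R (fun _ => (1 : ℝ)) z.1) ^ 2) / (2 * σ ^ 2)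

lemma meas_llr {d : ℕ} (σ θ : ℝ) {R R0 : Set (Sph d)} (hR : MeasurableSet R)
    (hR0 : MeasurableSet R0) : Measurable (loglr σ θ R R0) := by
  have : Measurable (Set.indicator R (fun _ => (1 : ℝ))) := measurable_const.indicator hR
  have : Measurable (Set.indicator R0 (fun _ => (1 : ℝ))) := measurable_const.indicator hR0
  unfold loglr
  fun_prop

lemma oneLaw_density (d : ℕ) [NeZero d] (σ θ : ℝ) (hσ : 0 < σ) (R R0 : Set (Sph d))
    (hR : MeasurableSet R) (hR0 : MeasurableSet R0) :
    oneLaw d σ θ R0 = (oneLaw d σ θ R).withDensity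
      (fun z => ENNReal.ofReal (Real.exp (-loglr σ θ R R0 z))) := by
  have hm := meas_llr σ θ hR hR0
  ext A hA
  rw [withDensity_apply _ hA, ← lintegral_indicator hA, ← lintegral_indicator_one hA,
    oneLaw_lintegral d σ θ hσ R0 hR0 _ (measurable_one.indicator hA),
    oneLaw_lintegral d σ θ hσ R hR _ (Measurable.indicator (by fun_prop) hA)]
  congr 1
  ext x
  congr 1
  ext y
  by_cases hz : (x, y) ∈ A
  · simp only [Set.indicator_of_mem hz, Pi.one_apply, mul_one, gaussianPDF]
    rw [← ENNReal.ofReal_mul (gaussianPDFReal_nonneg _ _ _)]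
    congr 1
    simp only [gaussianPDFReal, loglr, vr_coe]
    rw [mul_assoc _ (Real.exp _) (Real.exp _), ← Real.exp_add]
    congr 2
    ring
  · simp [Set.indicator_of_notMem hz]

lemma oneLaw_llr (d : ℕ) [NeZero d] (σ θ : ℝ) (hσ : 0 < σ) (R R0 : Set (Sph d))
    (hR : MeasurableSet R) (hR0 : MeasurableSet R0) :
    Integrable (loglr σ θ R R0) (oneLaw d σ θ R) ∧
    ∫ z, loglr σ θ R R0 z ∂(oneLaw d σ θ R) = θ ^ 2 / (2 * σ ^ 2) * (unifSph d (R ∆ R0)).toReal := by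
  have hm := meas_llr σ θ hR hR0
  have hs := meas_shift θ hR
  set a : Sph d → ℝ := Set.indicator R (fun _ => (1 : ℝ)) with ha
  set b : Sph d → ℝ := Set.indicator R0 (fun _ => (1 : ℝ)) with hb
  have ham : Measurable a := measurable_const.indicator hR
  have hbm : Measurable b := measurable_const.indicator hR0
  set G := gaussianReal 0 (vr σ)
  have hGi : Integrable (fun y : ℝ => y) G := (memLp_id_gaussianReal 1).integrable (by simp)
  have hcomp : ∀ z : Sph d × ℝ, loglr σ θ R R0 (z.1, θ * a z.1 + z.2) =
      θ ^ 2 / (2 * σ ^ 2) * (R ∆ R0).indicator (fun _ => (1 : ℝ)) z.1 +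
      (θ / σ ^ 2 * (a z.1 - b z.1)) * z.2 := by
    intro z
    have : (R ∆ R0).indicator (fun _ => (1 : ℝ)) z.1 = (a z.1 - b z.1) ^ 2 := by
      by_cases h1 : z.1 ∈ R <;> by_cases h2 : z.1 ∈ R0 <;>
        simp [ha, hb, h1, h2, Set.mem_symmDiff]
    rw [this]
    simp only [loglr, ← ha, ← hb]
    field_simp
    ring
  have hab : Integrable (fun x => θ / σ ^ 2 * (a x - b x)) (unifSph d) := by
    refine ((Integrable.sub ?_ ?_)).const_mul _
    · exact (integrable_const _).indicator hR
    · exact (integrable_const _).indicator hR0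
  have hi2 : Integrable (fun z : Sph d × ℝ => (θ / σ ^ 2 * (a z.1 - b z.1)) * z.2)
      ((unifSph d).prod G) := hab.mul_prod hGi
  have hi1' : Integrable (fun x => θ ^ 2 / (2 * σ ^ 2) * (R ∆ R0).indicator (fun _ => (1 : ℝ)) x)
      (unifSph d) := ((integrable_const _).indicator (hR.symmDiff hR0)).const_mul _
  have hi1 : Integrable (fun z : Sph d × ℝ =>
      θ ^ 2 / (2 * σ ^ 2) * (R ∆ R0).indicator (fun _ => (1 : ℝ)) z.1) ((unifSph d).prod G) :=
    hi1'.comp_fst G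
  constructor
  · unfold oneLaw
    rw [integrable_map_measure hm.aestronglyMeasurable hs.aemeasurable]
    refine (hi1.add hi2).congr (Filter.Eventually.of_forall fun z => ?_)
    exact (hcomp z).symm
  · unfold oneLaw
    rw [integral_map hs.aemeasurable hm.aestronglyMeasurable]
    simp_rw [hcomp]
    rw [integral_add hi1 hi2, integral_prod_mul (fun x => θ / σ ^ 2 * (a x - b x)) (fun y : ℝ => y),
      integral_id_gaussianReal, mul_zero, add_zero, integral_fun_fst
      (fun x => θ ^ 2 / (2 * σ ^ 2) * (R ∆ R0).indicator (fun _ => (1 : ℝ)) x)]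
    rw [integral_const_mul, integral_indicator_const _ (hR.symmDiff hR0)]
    simp [Measure.real]

lemma young_joint (d n : ℕ) [NeZero d] (σ θ : ℝ) (hσ : 0 < σ) (R R0 : Set (Sph d))
    (hR : MeasurableSet R) (hR0 : MeasurableSet R0)
    (A : Set (Fin n → Sph d × ℝ)) (hA : MeasurableSet A) (s : ℝ) :
    s * (jointLaw d n σ θ R).real A ≤
      n * (θ ^ 2 / (2 * σ ^ 2) * (unifSph d (R ∆ R0)).toReal) +
      (jointLaw d n σ θ R0).real A * (Real.exp s - 1) := by
  have := Fact.mk hR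
  have := Fact.mk hR0
  obtain ⟨h1, h2⟩ := oneLaw_llr d σ θ hσ R R0 hR hR0
  rw [jointLaw_eq, jointLaw_eq, ← h2]
  exact young_pi n _ _ _ (meas_llr σ θ hR hR0) h1 (oneLaw_density d σ θ hσ R R0 hR hR0) A hA s

instance jointLaw_prob (d n : ℕ) [NeZero d] (σ θ : ℝ) (R : Set (Sph d)) [hR : Fact (MeasurableSet R)] :
    IsProbabilityMeasure (jointLaw d n σ θ R) := by
  rw [jointLaw_eq]; infer_instance
lemma hamming_count (m : ℕ) (B : Finset (Fin m → Bool))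
    (hB : ∀ v ∈ B, ∀ w ∈ B, 16 * hammingDist v w ≤ m) : (B.card : ℝ) ≤ (4 / 3) ^ m := by
  rcases B.eq_empty_or_nonempty with rfl | ⟨v0, h0⟩
  · simp only [Finset.card_empty, Nat.cast_zero]
    positivity
  have hsum : ∑ v : Fin m → Bool, (1 / 16 : ℝ) ^ hammingDist v v0 = (17 / 16) ^ m := by
    have h1 : ∀ v : Fin m → Bool, (1 / 16 : ℝ) ^ hammingDist v v0 =
        ∏ i, (if v i ≠ v0 i then (1 / 16 : ℝ) else 1) := by
      intro v
      rw [Finset.prod_ite, Finset.prod_const, Finset.prod_const_one, mul_one]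
      rfl
    simp_rw [h1]
    have := Finset.prod_univ_sum (fun _ : Fin m => (Finset.univ : Finset Bool))
      (fun i b => if b ≠ v0 i then (1 / 16 : ℝ) else 1)
    rw [Fintype.piFinset_univ] at this
    rw [← this]
    have h2 : ∀ i, ∑ b : Bool, (if b ≠ v0 i then (1 / 16 : ℝ) else 1) = 17 / 16 := by
      intro i
      cases v0 i <;> simp <;> norm_num
    simp only [h2]
    rw [Finset.prod_const, Finset.card_univ, Fintype.card_fin]
  have h3 : (B.card : ℝ) * (4 / 5) ^ m ≤ (17 / 16) ^ m := by
    rw [← hsum, ← nsmul_eq_mul, ← Finset.sum_const]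
    refine le_trans (Finset.sum_le_sum (f := fun _ => (4 / 5 : ℝ) ^ m)
      (g := fun v => (1 / 16 : ℝ) ^ hammingDist v v0) fun v hv => ?_)
      (Finset.sum_le_sum_of_subset_of_nonneg (Finset.subset_univ B) fun _ _ _ => by positivity)
    calc (4 / 5 : ℝ) ^ m ≤ (4 / 5 : ℝ) ^ (16 * hammingDist v v0) :=
          pow_le_pow_of_le_one (by norm_num) (by norm_num) (hB v hv v0 h0)
      _ = ((4 / 5 : ℝ) ^ 16) ^ hammingDist v v0 := pow_mul _ _ _
      _ ≤ _ := pow_le_pow_left₀ (by norm_num) (by norm_num) _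
  have h4 : (17 / 16 : ℝ) ^ m ≤ (4 / 3) ^ m * (4 / 5) ^ m := by
    rw [← mul_pow]
    exact pow_le_pow_left₀ (by norm_num) (by norm_num) _
  exact le_of_mul_le_mul_right (h3.trans h4) (by positivity)

/-- base direction -/
noncomputable def ebase (m : ℕ) : EuclideanSpace ℝ (Fin (m + 1)) :=
  WithLp.toLp 2 (Fin.cons (1 : ℝ) (fun _ : Fin m => (0 : ℝ)))

/-- hypercube directions -/
noncomputable def fdir {m : ℕ} (v : Fin m → Bool) : EuclideanSpace ℝ (Fin (m + 1)) :=
  WithLp.toLp 2 (Fin.cons (0 : ℝ) (fun i : Fin m => (if v i then (1 : ℝ) else -1) / √m))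

lemma ee (m : ℕ) : ⟪ebase m, ebase m⟫ = 1 := by
  simp only [ebase, PiLp.inner_apply, Fin.sum_univ_succ, Fin.cons_zero, Fin.cons_succ]
  simp

lemma ef {m : ℕ} (v : Fin m → Bool) : ⟪ebase m, fdir v⟫ = 0 := by
  simp [ebase, fdir, PiLp.inner_apply, Fin.sum_univ_succ]

lemma ff {m : ℕ} (hm : 0 < m) (v w : Fin m → Bool) :
    ⟪fdir v, fdir w⟫ = 1 - 2 * (hammingDist v w : ℝ) / m := by
  have hm' : (0 : ℝ) < m := by exact_mod_cast hm
  have h1 : ⟪fdir v, fdir w⟫ = ∑ i : Fin m, (1 - 2 * (if v i ≠ w i then (1 : ℝ) else 0)) / m := by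
    simp only [fdir, PiLp.inner_apply, Fin.sum_univ_succ]
    simp only [Fin.cons_zero, Fin.cons_succ, inner_zero_left, zero_add]
    refine Finset.sum_congr rfl fun i _ => ?_
    have : √(m : ℝ) * √m = m := Real.mul_self_sqrt hm'.le
    have h2 : √(m : ℝ) ≠ 0 := (Real.sqrt_pos.2 hm').ne'
    simp only [RCLike.inner_apply, RCLike.conj_to_real]
    rw [div_mul_div_comm, this]
    congr 1
    cases v i <;> cases w i <;> norm_num
  rw [h1, ← Finset.sum_div, Finset.sum_sub_distrib, ← Finset.mul_sum, Finset.sum_boole]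
  have : (hammingDist v w) = (Finset.univ.filter (fun i => v i ≠ w i)).card := rfl
  rw [this]
  simp only [Finset.sum_const, Finset.card_univ, Fintype.card_fin, nsmul_eq_mul, mul_one]
  field_simp

/-- the hypotheses -/
noncomputable def hyp {m : ℕ} (t : ℝ) (v : Fin m → Bool) : EuclideanSpace ℝ (Fin (m + 1)) :=
  Real.cos t • ebase m + Real.sin t • fdir v

lemma norm_one_of {E : Type*} [NormedAddCommGroup E] [InnerProductSpace ℝ E] {x : E}
    (h : ⟪x, x⟫ = 1) : ‖x‖ = 1 := by
  rw [real_inner_self_eq_norm_sq] at h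
  nlinarith [norm_nonneg x]

lemma ff_self {m : ℕ} (hm : 0 < m) (v : Fin m → Bool) : ⟪fdir v, fdir v⟫ = 1 := by
  rw [ff hm, hammingDist_self]; simp

lemma hyp_inner {m : ℕ} (hm : 0 < m) (t : ℝ) (v w : Fin m → Bool) :
    ⟪hyp t v, hyp t w⟫ = 1 - 2 * Real.sin t ^ 2 * ((hammingDist v w : ℝ) / m) := by
  have hsc := Real.sin_sq_add_cos_sq t
  have h1 := ef v
  have h2 := ef w
  rw [real_inner_comm] at h1
  simp only [hyp, inner_add_left, inner_add_right, inner_smul_left, inner_smul_right,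
    RCLike.conj_to_real, ee, h1, h2, ff hm]
  linear_combination hsc

lemma hyp_norm {m : ℕ} (hm : 0 < m) (t : ℝ) (v : Fin m → Bool) : ‖hyp t v‖ = 1 := by
  apply norm_one_of
  rw [hyp_inner hm, hammingDist_self]; simp

lemma base_le {m : ℕ} (hm : 0 < m) (k : ℕ) (v : Fin m → Bool) :
    Dd (ebase m) (hyp (Real.pi / 2 ^ (k + 1)) v) ≤ 1 / 2 ^ k := by
  unfold hyp
  rw [Dd_half (norm_one_of (ee m)) (norm_one_of (ff_self hm v)) (ef v)]
  have := Dd_le_one (ebase m) (fdir v)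
  gcongr

lemma pair_ge {m : ℕ} (hm : 0 < m) (k : ℕ) (hk : 1 ≤ k) (v w : Fin m → Bool)
    (h : m ≤ 16 * hammingDist v w) :
    1 / 2 ^ (k + 3) ≤ Dd (hyp (Real.pi / 2 ^ (k + 1)) v) (hyp (Real.pi / 2 ^ (k + 1)) w) := by
  have hm' : (0 : ℝ) < m := by exact_mod_cast hm
  set t := Real.pi / 2 ^ (k + 1) with ht
  have htpos : 0 < t := by positivity
  have htlt : t < Real.pi / 2 := by
    rw [ht]
    apply div_lt_div_of_pos_left Real.pi_pos (by norm_num)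
    calc (2 : ℝ) = 2 ^ 1 := by norm_num
      _ < 2 ^ (k + 1) := pow_lt_pow_right₀ (by norm_num) (by omega)
  have hsc := Real.sin_sq_add_cos_sq t
  have hc : 0 < Real.cos t := Real.cos_pos_of_mem_Ioo ⟨by linarith, htlt⟩
  set f := (-Real.sin t) • ebase m + Real.cos t • fdir v with hf
  have h1 := ef v
  have h1' := h1
  rw [real_inner_comm] at h1'
  have hff : ⟪f, f⟫ = 1 := by
    simp only [hf, inner_add_left, inner_add_right, inner_smul_left, inner_smul_right,
      RCLike.conj_to_real, ee, h1, h1', ff_self hm]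
    linear_combination hsc
  have hef : ⟪hyp t v, f⟫ = 0 := by
    simp only [hf, hyp, inner_add_left, inner_add_right, inner_smul_left, inner_smul_right,
      RCLike.conj_to_real, ee, h1, h1', ff_self hm]
    ring
  have hs : Real.pi / 2 ^ (k + 2 + 1) = t / 4 := by
    rw [ht]; rw [show k + 2 + 1 = (k + 1) + 2 by ring, pow_add]; field_simp; norm_num
  have hhalf := Dd_half (hyp_norm hm t v) (norm_one_of hff) hef (k + 2)
  rw [hs] at hhalf
  have horth := Dd_orth hef (by intro h; rw [h] at hff; simp at hff)
  have hle : (1 : ℝ) / 2 ^ (k + 3) ≤ Dd (hyp t v) f / 2 ^ (k + 2) := by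
    rw [show k + 3 = (k + 2) + 1 by ring, pow_succ, div_le_div_iff₀ (by positivity) (by positivity)]
    have : (0 : ℝ) < 2 ^ (k + 2) := by positivity
    nlinarith
  refine hle.trans ?_
  rw [← hhalf]
  set r := (hammingDist v w : ℝ) / m with hr
  have hr1 : r ≤ 1 := by
    rw [hr, div_le_one hm']
    have := hammingDist_le_card_fintype (x := v) (y := w)
    rw [Fintype.card_fin] at this
    exact_mod_cast this
  have hr2 : 1 / 16 ≤ r := by
    rw [hr, le_div_iff₀ hm']
    have : (m : ℝ) ≤ 16 * hammingDist v w := by exact_mod_cast h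
    linarith
  apply Dd_mono (hyp_norm hm t v) (norm_one_of hff) (hyp_norm hm t w) hef (by linarith) (by linarith)
  · rw [hyp_inner hm, ← hr]
    have e1 : Real.cos (t / 4) = 1 - 2 * Real.sin (t / 8) ^ 2 := by
      rw [show t / 4 = 2 * (t / 8) by ring, Real.cos_two_mul, Real.cos_sq']; ring
    have e2 : Real.sin (t / 8) ≤ t / 8 := Real.sin_le (by linarith)
    have e3 : 0 < Real.sin (t / 8) := Real.sin_pos_of_pos_of_lt_pi (by linarith) (by linarith)
    have e4 : 2 / Real.pi * t ≤ Real.sin t := Real.mul_le_sin htpos.le htlt.le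
    have e5 : t / 2 ≤ 2 / Real.pi * t := by
      have : (1 : ℝ) / 2 ≤ 2 / Real.pi := by
        rw [div_le_div_iff₀ (by norm_num) Real.pi_pos]
        linarith [Real.pi_le_four]
      nlinarith
    have e6 : Real.sin (t / 8) ≤ Real.sin t / 4 := by linarith
    have e7 : Real.sin (t / 8) ^ 2 ≤ (Real.sin t / 4) ^ 2 := pow_le_pow_left₀ e3.le e6 2
    rw [e1]
    nlinarith [sq_nonneg (Real.sin t)]
  · rw [hyp_inner hm, ← hr]
    nlinarith [sq_nonneg (Real.sin t), pow_pos hc 2]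

lemma popLoss_tri {d : ℕ} [NeZero d] (T A B : Set (Sph d)) :
    popLoss d A B ≤ popLoss d T A + popLoss d T B := by
  have key : ∀ X Y Z : Set (Sph d), X ⊆ Y ∪ Z → (unifSph d X).toReal ≤
      (unifSph d Y).toReal + (unifSph d Z).toReal := fun X Y Z h =>
    (measureReal_mono h).trans (measureReal_union_le Y Z)
  have h1 := key (A ∆ B) (T ∆ A) (T ∆ B) (fun x => by
    simp only [Set.mem_symmDiff, Set.mem_union]; tauto)
  have h2 := key (A ∆ B) (T ∆ Aᶜ) (T ∆ Bᶜ) (fun x => by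
    simp only [Set.mem_symmDiff, Set.mem_union, Set.mem_compl_iff]; tauto)
  have h3 := key (A ∆ Bᶜ) (T ∆ Aᶜ) (T ∆ B) (fun x => by
    simp only [Set.mem_symmDiff, Set.mem_union, Set.mem_compl_iff]; tauto)
  have h4 := key (A ∆ Bᶜ) (T ∆ A) (T ∆ Bᶜ) (fun x => by
    simp only [Set.mem_symmDiff, Set.mem_union, Set.mem_compl_iff]; tauto)
  unfold popLoss
  have m1 := min_le_left (unifSph d (A ∆ B)).toReal (unifSph d (A ∆ Bᶜ)).toReal
  have m2 := min_le_right (unifSph d (A ∆ B)).toReal (unifSph d (A ∆ Bᶜ)).toReal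
  rcases min_choice (unifSph d (T ∆ A)).toReal (unifSph d (T ∆ Aᶜ)).toReal with h | h <;>
  rcases min_choice (unifSph d (T ∆ B)).toReal (unifSph d (T ∆ Bᶜ)).toReal with h' | h' <;>
  rw [h, h'] <;> linarith

lemma popLoss_nonneg {d : ℕ} (A B : Set (Sph d)) : 0 ≤ popLoss d A B :=
  le_min ENNReal.toReal_nonneg ENNReal.toReal_nonneg

lemma popLoss_le_one {d : ℕ} [NeZero d] (A B : Set (Sph d)) : popLoss d A B ≤ 1 :=
  (min_le_left _ _).trans (measureReal_le_one (μ := unifSph d))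

lemma meas_popLoss {d : ℕ} [NeZero d] {B : Set (Sph d)} (hB : MeasurableSet B) :
    Measurable (fun ab : Sph d × ℝ => popLoss d (disc ab.1 ab.2) B) := by
  have h : ∀ B : Set (Sph d), MeasurableSet B →
      Measurable (fun ab : Sph d × ℝ => (unifSph d (disc ab.1 ab.2 ∆ B)).toReal) := by
    intro B hB
    have h1 : MeasurableSet {q : (Sph d × ℝ) × Sph d | q.2 ∈ disc q.1.1 q.1.2} := by
      exact measurableSet_le (f := fun q : (Sph d × ℝ) × Sph d => q.1.2)
        (g := fun q : (Sph d × ℝ) × Sph d =>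
          ⟪(q.2 : EuclideanSpace ℝ (Fin d)), (q.1.1 : EuclideanSpace ℝ (Fin d))⟫)
        (by fun_prop) (by fun_prop)
    have h2 : MeasurableSet {q : (Sph d × ℝ) × Sph d | q.2 ∈ B} := measurable_snd hB
    exact (measurable_measure_prodMk_left (ν := unifSph d) (h1.symmDiff h2)).ennreal_toReal
  exact (h B hB).min (h Bᶜ hB.compl)

lemma popLoss_pair {d : ℕ} [NeZero d] {A B : Set (Sph d)} (hA : MeasurableSet A)
    (hB : MeasurableSet B) {c : ℝ} (h1 : c ≤ (unifSph d (A ∆ B)).toReal)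
    (h2 : (unifSph d (A ∆ B)).toReal ≤ 1 - c) : c ≤ popLoss d A B := by
  refine le_min h1 ?_
  have : A ∆ Bᶜ = (A ∆ B)ᶜ := by
    ext x; simp only [Set.mem_symmDiff, Set.mem_compl_iff]; tauto
  have h3 := probReal_compl_eq_one_sub (μ := unifSph d) (hA.symmDiff hB)
  rw [this]
  simp only [Measure.real] at h3
  rw [h3]; linarith

lemma log_bound : (0.4 : ℝ) ≤ Real.log (3 / 2) := by
  rw [Real.le_log_iff_exp_le (by norm_num)]
  have h1 := Real.exp_one_lt_d9
  have h2 : Real.exp 0.4 ^ 5 = Real.exp 1 ^ 2 := by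
    rw [← Real.exp_nat_mul, ← Real.exp_nat_mul]; norm_num
  by_contra h
  push Not at h
  have h3 : (3 / 2 : ℝ) ^ 5 < Real.exp 0.4 ^ 5 := pow_lt_pow_left₀ h (by norm_num) (by norm_num)
  rw [h2] at h3
  have h4 : Real.exp 1 ^ 2 ≤ 2.7182818286 ^ 2 := pow_le_pow_left₀ (Real.exp_pos 1).le h1.le 2
  norm_num at h3 h4
  linarith

theorem core (m : ℕ) (hm : 0 < m) (σ θ : ℝ) (hσ : 0 < σ) (hθ : 0 < θ) (n : ℕ) (hn : 1 ≤ n)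
    (hr : ((m + 1 : ℕ) : ℝ) * σ ^ 2 / ((n : ℝ) * θ ^ 2) ≤ 1)
    (est : (Fin n → Sph (m + 1) × ℝ) → Sph (m + 1) × ℝ) (hest : Measurable est) :
    ∃ α : Sph (m + 1), (1 / 2 ^ 14) * (((m + 1 : ℕ) : ℝ) * σ ^ 2 / ((n : ℝ) * θ ^ 2)) ≤
      ∫ data, popLoss (m + 1) (disc (est data).1 (est data).2) (disc α 0)
        ∂(jointLaw (m + 1) n σ θ (disc α 0)) := by
  have hm' : (0 : ℝ) < m := by exact_mod_cast hm
  have hm1 : (1 : ℝ) ≤ m := by exact_mod_cast hm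
  have hn' : (0 : ℝ) < n := by exact_mod_cast hn
  set r := ((m + 1 : ℕ) : ℝ) * σ ^ 2 / ((n : ℝ) * θ ^ 2) with hrdef
  have hrpos : 0 < r := by positivity
  obtain ⟨k0, hk1, hk2⟩ := exists_nat_pow_near_of_lt_one (x := r / 64) (y := (1 / 2 : ℝ))
    (by positivity) (by linarith) (by norm_num) (by norm_num)
  set k := k0 + 1 with hk
  have hkp : (1 / 2 : ℝ) ^ k = 1 / 2 ^ k := by rw [div_pow, one_pow]
  have hk3 : (1 : ℝ) / 2 ^ k ≤ r / 64 := by rw [← hkp]; exact hk1.le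
  have hk4 : r / 64 ≤ 2 * (1 / 2 ^ k) := by
    rw [← hkp, hk, pow_succ]; linarith
  have hk5 : (1 : ℝ) / 2 ^ k ≤ 1 / 64 := by linarith
  set t := Real.pi / 2 ^ (k + 1) with ht
  let α : (Fin m → Bool) → Sph (m + 1) := fun v => ⟨hyp t v, by simp [hyp_norm hm t v]⟩
  let e0 : Sph (m + 1) := ⟨ebase m, by simp [norm_one_of (ee m)]⟩
  let P : (Fin m → Bool) → Measure (Fin n → Sph (m + 1) × ℝ) :=
    fun v => jointLaw (m + 1) n σ θ (disc (α v) 0)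
  let Q := jointLaw (m + 1) n σ θ (disc e0 0)
  have hFact : ∀ a : Sph (m + 1), Fact (MeasurableSet (disc a 0)) :=
    fun a => ⟨measurableSet_disc a 0⟩
  have hPp : ∀ v, IsProbabilityMeasure (P v) := fun v => jointLaw_prob _ _ _ _ _
  have hQp : IsProbabilityMeasure Q := jointLaw_prob _ _ _ _ _
  let L : (Fin m → Bool) → (Fin n → Sph (m + 1) × ℝ) → ℝ := fun v data =>
    popLoss (m + 1) (disc (est data).1 (est data).2) (disc (α v) 0)
  have hL : ∀ v, Measurable (L v) := fun v =>
    (meas_popLoss (measurableSet_disc (α v) 0)).comp hest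
  set δ : ℝ := 1 / 2 ^ (k + 4) with hδ
  have hδpos : 0 < δ := by positivity
  have hδk : δ = 1 / 2 ^ k / 16 := by rw [hδ, pow_add]; field_simp; norm_num
  let A : (Fin m → Bool) → Set (Fin n → Sph (m + 1) × ℝ) := fun v => {data | L v data < δ}
  have hA : ∀ v, MeasurableSet (A v) := fun v => measurableSet_lt (hL v) measurable_const
  -- the closeness of hypotheses that fit the same data
  have hclose : ∀ data v w, data ∈ A v → data ∈ A w → 16 * hammingDist v w ≤ m := by
    intro data v w hv hw
    by_contra hlt
    push Not at hlt
    have h1 := pair_ge hm k (by omega) v w hlt.le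
    have h2 := Dd_triangle (hyp t v) (ebase m) (hyp t w)
    rw [Dd_comm (hyp t v) (ebase m)] at h2
    have h3 := base_le hm k v
    have h4 := base_le hm k w
    have h5 := unif_disc (α v) (α w)
    have h6 : (1 : ℝ) / 2 ^ (k + 3) = 2 * δ := by
      rw [hδ, show k + 4 = k + 3 + 1 by ring, pow_succ (n := k + 3)]; field_simp
    have h7 : 2 * δ ≤ popLoss (m + 1) (disc (α v) 0) (disc (α w) 0) := by
      apply popLoss_pair (measurableSet_disc _ _) (measurableSet_disc _ _)
      · rw [h5, ← h6]; exact h1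
      · rw [h5]
        change Dd (hyp t v) (hyp t w) ≤ _
        linarith
    have h8 := popLoss_tri (disc (est data).1 (est data).2) (disc (α v) 0) (disc (α w) 0)
    have h9 : L v data < δ := hv
    have h10 : L w data < δ := hw
    change _ ≤ L v data + L w data at h8
    linarith
  -- total mass under the reference
  have hQsum : ∑ v, Q.real (A v) ≤ (4 / 3) ^ m := by
    have h1 : ∑ v, Q.real (A v) = ∫ data, ∑ v, (A v).indicator (fun _ => (1 : ℝ)) data ∂Q := by
      rw [integral_finsetSum _ fun v _ => (integrable_const _).indicator (hA v)]
      refine Finset.sum_congr rfl fun v _ => ?_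
      rw [integral_indicator_const _ (hA v)]; simp
    rw [h1]
    have h2 : ∫ data, ∑ v, (A v).indicator (fun _ => (1 : ℝ)) data ∂Q ≤
        ∫ _, ((4 / 3 : ℝ) ^ m) ∂Q := by
      apply integral_mono (integrable_finsetSum _ fun v _ => (integrable_const _).indicator (hA v))
        (integrable_const _)
      intro data
      classical
      have h3 := hamming_count m (Finset.univ.filter fun v => data ∈ A v) (by
        intro v hv w hw
        exact hclose data v w (Finset.mem_filter.1 hv).2 (Finset.mem_filter.1 hw).2)
      rw [Finset.card_filter] at h3
      push_cast at h3
      refine le_trans (le_of_eq ?_) h3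
      refine Finset.sum_congr rfl fun v _ => ?_
      simp [Set.indicator_apply]
    simpa using h2
  -- Young
  set s := m * Real.log (3 / 2) with hs
  have hexp : Real.exp s = (3 / 2) ^ m := by
    rw [hs, Real.exp_nat_mul, Real.exp_log (by norm_num)]
  have hY : ∀ v, s * (P v).real (A v) ≤ m / 64 + Q.real (A v) * ((3 / 2) ^ m - 1) := by
    intro v
    have h1 := young_joint (m + 1) n σ θ hσ (disc (α v) 0) (disc e0 0) (measurableSet_disc _ _)
      (measurableSet_disc _ _) (A v) (hA v) s
    rw [hexp, unif_disc, Dd_comm] at h1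
    have h2 : Dd (ebase m) (hyp t v) ≤ r / 64 := (base_le hm k v).trans hk3
    have h3 : (n : ℝ) * (θ ^ 2 / (2 * σ ^ 2) * Dd (ebase m) (hyp t v)) ≤ m / 64 := by
      calc _ ≤ (n : ℝ) * (θ ^ 2 / (2 * σ ^ 2) * (r / 64)) := by gcongr
        _ = (m + 1) / 128 := by
          rw [hrdef]; push_cast; field_simp; norm_num
        _ ≤ _ := by linarith
    refine h1.trans ?_
    gcongr
  have hex : ∃ v, (P v).real (A v) ≤ 7 / 8 := by
    by_contra hcon
    push Not at hcon
    have hspos : 0 < s := by rw [hs]; have := log_bound; positivity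
    have h1 : ∑ v : Fin m → Bool, s * (7 / 8) ≤
        ∑ v, (m / 64 + Q.real (A v) * ((3 / 2) ^ m - 1)) :=
      Finset.sum_le_sum fun v _ =>
        (mul_le_mul_of_nonneg_left (hcon v).le hspos.le).trans (hY v)
    rw [Finset.sum_add_distrib, Finset.sum_const, Finset.sum_const, ← Finset.sum_mul] at h1
    simp only [Finset.card_univ, Fintype.card_fun, Fintype.card_bool, Fintype.card_fin,
      nsmul_eq_mul, Nat.cast_pow, Nat.cast_ofNat] at h1
    have h32 : (1 : ℝ) ≤ (3 / 2) ^ m := one_le_pow₀ (by norm_num)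
    have h2 : (∑ v, Q.real (A v)) * ((3 / 2) ^ m - 1) ≤ (4 / 3) ^ m * ((3 / 2) ^ m - 1) :=
      mul_le_mul_of_nonneg_right hQsum (by linarith)
    have h3 : (4 / 3 : ℝ) ^ m * ((3 / 2) ^ m - 1) = 2 ^ m * (1 - (2 / 3) ^ m) := by
      rw [mul_sub, mul_sub, ← mul_pow, ← mul_pow]; norm_num
    have h4 : 1 + (m : ℝ) * (-(1 / 3)) ≤ (1 + -(1 / 3)) ^ m := one_add_mul_le_pow (by norm_num) m
    norm_num at h4
    have h5 : (2 : ℝ) ^ m * (s * (7 / 8)) ≤ 2 ^ m * (m / 64 + m / 3) := by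
      have : (2 : ℝ) ^ m * (1 - (2 / 3) ^ m) ≤ 2 ^ m * (m / 3) := by
        gcongr; linarith
      rw [mul_add]; linarith
    have h6 := le_of_mul_le_mul_left h5 (by positivity)
    have h7 : (m : ℝ) * 0.4 ≤ s := by rw [hs]; have := log_bound; gcongr
    norm_num at h7
    linarith
  obtain ⟨v, hv⟩ := hex
  refine ⟨α v, ?_⟩
  have hLi : Integrable (L v) (P v) := by
    refine Integrable.of_bound (hL v).aestronglyMeasurable 1 (Filter.Eventually.of_forall fun z => ?_)
    rw [Real.norm_of_nonneg (popLoss_nonneg _ _)]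
    exact popLoss_le_one _ _
  have h1 : δ * (1 / 8) ≤ ∫ data, L v data ∂(P v) := by
    have h2 : (P v).real (A v)ᶜ = 1 - (P v).real (A v) := probReal_compl_eq_one_sub (hA v)
    have h3 : ∫ data, (A v)ᶜ.indicator (fun _ => δ) data ∂(P v) ≤ ∫ data, L v data ∂(P v) := by
      apply integral_mono ((integrable_const _).indicator (hA v).compl) hLi
      intro data
      by_cases hd : data ∈ A v
      · simp only [Set.indicator_of_notMem (Set.notMem_compl_iff.2 hd)]
        exact popLoss_nonneg _ _
      · simp only [Set.indicator_of_mem (Set.mem_compl hd)]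
        exact not_lt.1 hd
    rw [integral_indicator_const _ (hA v).compl, smul_eq_mul, h2] at h3
    nlinarith
  refine le_trans ?_ h1
  rw [hδk]
  norm_num
  norm_num at hk4
  linarith

/-- Proposition (minimax lower bound): no measurable estimator of a single disc-shaped change
region can achieve a rate faster than `C d σ² / (n θ²)` in the population loss. -/
theorem statement8 :
    ∃ C : ℝ, 0 < C ∧
      ∀ d : ℕ, 2 ≤ d →
        ∀ σ θ : ℝ, 0 < σ → 0 < θ →
          ∀ n : ℕ, 1 ≤ n →
            (d : ℝ) * σ ^ 2 / ((n : ℝ) * θ ^ 2) ≤ 1 →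
            ∀ est : (Fin n → Sph d × ℝ) → Sph d × ℝ, Measurable est →
              (∀ data, (est data).2 ∈ Set.Icc (0 : ℝ) 1) →
              C * (d : ℝ) * σ ^ 2 / ((n : ℝ) * θ ^ 2) ≤
                ⨆ α : Sph d, ⨆ β : (Set.Icc (0 : ℝ) 1),
                  ∫ data, popLoss d (disc (est data).1 (est data).2) (disc α (β : ℝ))
                    ∂(jointLaw d n σ θ (disc α (β : ℝ))) := by
  refine ⟨1 / 2 ^ 14, by positivity, ?_⟩
  intro d hd σ θ hσ hθ n hn hr est hest _
  obtain ⟨m, rfl⟩ : ∃ m, d = m + 1 := ⟨d - 1, by omega⟩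
  obtain ⟨α, hα⟩ := core m (by omega) σ θ hσ hθ n hn hr est hest
  have hle : ∀ (a : Sph (m + 1)) (b : Set.Icc (0 : ℝ) 1),
      ∫ data, popLoss (m + 1) (disc (est data).1 (est data).2) (disc a (b : ℝ))
        ∂(jointLaw (m + 1) n σ θ (disc a (b : ℝ))) ≤ 1 := by
    intro a b
    have : Fact (MeasurableSet (disc a (b : ℝ))) := ⟨measurableSet_disc a b⟩
    have h1 := integral_mono_of_nonneg (μ := jointLaw (m + 1) n σ θ (disc a (b : ℝ)))
      (f := fun data => popLoss (m + 1) (disc (est data).1 (est data).2) (disc a (b : ℝ)))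
      (g := fun _ => (1 : ℝ)) (Filter.Eventually.of_forall fun z => popLoss_nonneg _ _)
      (integrable_const _) (Filter.Eventually.of_forall fun z => popLoss_le_one _ _)
    simpa using h1
  have : Nonempty (Set.Icc (0 : ℝ) 1) := ⟨⟨0, by simp⟩⟩
  have hb1 : ∀ a : Sph (m + 1), BddAbove (Set.range fun b : Set.Icc (0 : ℝ) 1 =>
      ∫ data, popLoss (m + 1) (disc (est data).1 (est data).2) (disc a (b : ℝ))
        ∂(jointLaw (m + 1) n σ θ (disc a (b : ℝ)))) := by
    intro a
    refine ⟨1, ?_⟩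
    rintro _ ⟨b, rfl⟩
    exact hle a b
  have hb2 : BddAbove (Set.range fun a : Sph (m + 1) => ⨆ b : Set.Icc (0 : ℝ) 1,
      ∫ data, popLoss (m + 1) (disc (est data).1 (est data).2) (disc a (b : ℝ))
        ∂(jointLaw (m + 1) n σ θ (disc a (b : ℝ)))) := by
    refine ⟨1, ?_⟩
    rintro _ ⟨a, rfl⟩
    exact ciSup_le fun b => hle a b
  refine le_trans ?_ (le_ciSup hb2 α)
  refine le_trans ?_ (le_ciSup (hb1 α) ⟨0, by simp⟩)
  refine le_trans (le_of_eq ?_) hα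
  ring
end

section
/- Let Ω be a set and let 𝒜_1, 𝒜_2 be families of subsets of Ω with VCD(𝒜_1) = k_1 and VCD(𝒜_2) = k_2 (both finite). If |Ω| ≥ k_1 + k_2 + 2, then VCD(𝒜_1 ∪ 𝒜_2) ≤ k_1 + k_2 + 1. -/
open scoped symmDiff ENNReal

open Classical in
theorem aux_card {Ω : Type*} (𝒜 : Set (Set Ω)) (k : ℕ) (h : VCD 𝒜 = (k : ℕ∞)) (S : Finset Ω) :
    ∃ G : Finset (Finset Ω), (S.powerset.filter
      (fun T : Finset Ω => ∃ A ∈ 𝒜, (S : Set Ω) ∩ A = (T : Set Ω))).card ≤ G.card ∧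
      ∀ t ∈ G, t ⊆ S ∧ t.card ≤ k := by
  refine ⟨_, Finset.card_le_card_shatterer _, ?_⟩
  intro t ht
  rw [Finset.mem_shatterer] at ht
  have hS : t ⊆ S := by
    obtain ⟨u, hu, htu⟩ := ht.exists_superset
    exact htu.trans (Finset.mem_powerset.1 (Finset.mem_filter.1 hu).1)
  refine ⟨hS, ?_⟩
  have hsh : Shatters 𝒜 t := by
    intro T hT
    obtain ⟨u, hu, rfl⟩ := ht hT
    obtain ⟨A, hA, hAu⟩ := (Finset.mem_filter.1 hu).2
    refine ⟨A, hA, ?_⟩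
    rw [Finset.coe_inter, ← hAu, ← Set.inter_assoc,
      Set.inter_eq_left.2 (Finset.coe_subset.2 hS)]
  have : (t.card : ℕ∞) ≤ VCD 𝒜 := by
    unfold VCD
    exact le_iSup₂_of_le t hsh le_rfl
  rw [h] at this
  exact_mod_cast this

/-- Lemma: if `VCD(𝒜₁) = k₁`, `VCD(𝒜₂) = k₂` and `|Ω| ≥ k₁ + k₂ + 2`, then
`VCD(𝒜₁ ∪ 𝒜₂) ≤ k₁ + k₂ + 1`. -/
theorem statement12 {Ω : Type*} (𝒜₁ 𝒜₂ : Set (Set Ω)) (k₁ k₂ : ℕ)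
    (h₁ : VCD 𝒜₁ = (k₁ : ℕ∞)) (h₂ : VCD 𝒜₂ = (k₂ : ℕ∞))
    (hΩ : ((k₁ + k₂ + 2 : ℕ) : ℕ∞) ≤ (Set.univ : Set Ω).encard) :
    VCD (𝒜₁ ∪ 𝒜₂) ≤ ((k₁ + k₂ + 1 : ℕ) : ℕ∞) := by
  classical
  unfold VCD
  refine iSup₂_le ?_
  intro S hS
  by_contra hlt
  have hn : k₁ + k₂ + 2 ≤ S.card := by
    have : k₁ + k₂ + 1 < S.card := by exact_mod_cast not_le.1 hlt
    omega
  obtain ⟨G₁, hc₁, hG₁⟩ := aux_card 𝒜₁ k₁ h₁ S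
  obtain ⟨G₂, hc₂, hG₂⟩ := aux_card 𝒜₂ k₂ h₂ S
  have hcov : S.powerset ⊆
      S.powerset.filter (fun T : Finset Ω => ∃ A ∈ 𝒜₁, (S : Set Ω) ∩ A = (T : Set Ω)) ∪
      S.powerset.filter (fun T : Finset Ω => ∃ A ∈ 𝒜₂, (S : Set Ω) ∩ A = (T : Set Ω)) := by
    intro T hT
    obtain ⟨A, hA, hAT⟩ := hS T (Finset.mem_powerset.1 hT)
    rw [Finset.mem_union, Finset.mem_filter, Finset.mem_filter]
    rcases hA with hA | hA
    · exact Or.inl ⟨hT, A, hA, hAT⟩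
    · exact Or.inr ⟨hT, A, hA, hAT⟩
  have hle := (Finset.card_le_card hcov).trans (Finset.card_union_le _ _)
  have himg : (G₂.image (fun t => S \ t)).card = G₂.card := by
    refine Finset.card_image_of_injOn ?_
    intro a ha b hb hab
    have hab' : S \ a = S \ b := hab
    rw [← Finset.sdiff_sdiff_eq_self (hG₂ a ha).1, hab', Finset.sdiff_sdiff_eq_self (hG₂ b hb).1]
  have himc : ∀ u ∈ G₂.image (fun t => S \ t), u ⊆ S ∧ k₁ + 2 ≤ u.card := by
    intro u hu
    obtain ⟨t, ht, rfl⟩ := Finset.mem_image.1 hu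
    refine ⟨Finset.sdiff_subset, ?_⟩
    have := hG₂ t ht
    rw [Finset.card_sdiff_of_subset this.1]
    omega
  have hdisj : Disjoint G₁ (G₂.image (fun t => S \ t)) := by
    rw [Finset.disjoint_left]
    intro u hu hu'
    have := (hG₁ u hu).2
    have := (himc u hu').2
    omega
  obtain ⟨W, hWS, hW⟩ := Finset.exists_subset_card_eq (show k₁ + 1 ≤ S.card by omega)
  have hss : G₁ ∪ G₂.image (fun t => S \ t) ⊂ S.powerset := by
    rw [Finset.ssubset_iff_of_subset]
    · refine ⟨W, Finset.mem_powerset.2 hWS, fun h => ?_⟩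
      rcases Finset.mem_union.1 h with h | h
      · have := (hG₁ W h).2
        omega
      · have := (himc W h).2
        omega
    · intro u hu
      rw [Finset.mem_powerset]
      rcases Finset.mem_union.1 hu with h | h
      · exact (hG₁ u h).1
      · exact (himc u h).1
  have hlt2 := Finset.card_lt_card hss
  rw [Finset.card_union_of_disjoint hdisj, himg] at hlt2
  omega
end

section
/- Fix d ≥ 2 and let 𝒜_{d−1} := { {x ∈ S^{d−1} : ⟨x, α⟩ ≥ β} : α ∈ S^{d−1}, β ∈ [−1, 1] } be the collection of discs on S^{d−1}. Then VCD(𝒜_{d−1}) ≥ d + 1. -/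
open scoped symmDiff ENNReal

open scoped RealInnerProductSpace

/-- The collection of discs `{x ∈ S^{d-1} : ⟨x, α⟩ ≥ β}` with `α ∈ S^{d-1}`, `β ∈ [−1,1]`. -/
def sphDiscs (d : ℕ) : Set (Set (Sph d)) :=
  {A | ∃ α : Sph d, ∃ β ∈ Set.Icc (-1 : ℝ) 1,
    A = {x : Sph d | β ≤ ⟪(x : EuclideanSpace ℝ (Fin d)), (α : EuclideanSpace ℝ (Fin d))⟫}}

lemma core_aux (d : ℕ) (i0 i1 : Fin d) (h01 : i1 ≠ i0) (P : Fin d → Prop) (Q : Prop) :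
    ∃ (v : EuclideanSpace ℝ (Fin d)) (b : ℝ), 0 < ‖v‖ ∧ |b| ≤ ‖v‖ ∧
      (∀ i, b ≤ v i ↔ P i) ∧ (b ≤ - v i0 ↔ Q) := by
  classical
  obtain ⟨c, b, hb, h1, h2, h3, h4⟩ : ∃ c b : ℝ, |b| ≤ 1 ∧ (b ≤ c ↔ P i0) ∧ (b ≤ -c ↔ Q) ∧
      b ≤ 1 ∧ -2 < b := by
    by_cases hP : P i0 <;> by_cases hQ : Q
    · exact ⟨0, -1, by norm_num, by simp [hP], by simp [hQ], by norm_num, by norm_num⟩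
    · exact ⟨1, 0, by norm_num, by simp [hP], by simp [hQ], by norm_num, by norm_num⟩
    · exact ⟨-1, 0, by norm_num, by simp [hP], by simp [hQ], by norm_num, by norm_num⟩
    · exact ⟨0, 1, by norm_num, by simp [hP], by simp [hQ], by norm_num, by norm_num⟩
  let v : EuclideanSpace ℝ (Fin d) :=
    WithLp.toLp 2 (fun i => if i = i0 then c else if P i then 1 else -2)
  have hv : (1 : ℝ) ≤ ‖v‖ := by
    have h := PiLp.norm_apply_le v i1
    refine le_trans ?_ h
    simp only [v, h01, if_false]
    split_ifs <;> norm_num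
  refine ⟨v, b, by linarith, by linarith, ?_, ?_⟩
  · intro i
    by_cases hi : i = i0
    · subst hi
      simpa [v] using h1
    · by_cases hp : P i
      · simp [v, hi, hp, h3]
      · simp [v, hi, hp, h4]
  · simpa [v] using h2

noncomputable def ptsAux (d : ℕ) (i0 : Fin d) : Option (Fin d) → Sph d
  | some i => ⟨EuclideanSpace.single i (1 : ℝ), by simp⟩
  | none => ⟨-EuclideanSpace.single i0 (1 : ℝ), by simp⟩

/-- Lemma: the collection of discs on `S^{d-1}` has VC dimension at least `d + 1`. -/
theorem statement14 (d : ℕ) (hd : 2 ≤ d) :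
    ((d : ℕ∞) + 1) ≤ VCD (sphDiscs d) := by
  classical
  let i0 : Fin d := ⟨0, by omega⟩
  let i1 : Fin d := ⟨1, by omega⟩
  have h01 : i1 ≠ i0 := by simp [i0, i1]
  have key : ∀ P : Option (Fin d) → Prop, ∃ α : Sph d, ∃ β ∈ Set.Icc (-1 : ℝ) 1,
      ∀ o, β ≤ ⟪(ptsAux d i0 o : EuclideanSpace ℝ (Fin d)), (α : EuclideanSpace ℝ (Fin d))⟫
        ↔ P o := by
    intro P
    obtain ⟨v, b, hv, hb, h1, h2⟩ := core_aux d i0 i1 h01 (fun i => P (some i)) (P none)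
    refine ⟨⟨‖v‖⁻¹ • v, ?_⟩, ‖v‖⁻¹ * b, ?_, ?_⟩
    · simp [norm_smul, hv.ne']
    · rw [Set.mem_Icc, ← abs_le, abs_mul, abs_of_pos (inv_pos.2 hv), inv_mul_le_iff₀ hv]
      simpa using hb
    · rintro (_ | i)
      · simp only [ptsAux, inner_smul_right, inner_neg_left, EuclideanSpace.inner_single_left]
        rw [mul_le_mul_iff_right₀ (inv_pos.2 hv)]
        simpa using h2
      · simp only [ptsAux, inner_smul_right, EuclideanSpace.inner_single_left]
        rw [mul_le_mul_iff_right₀ (inv_pos.2 hv)]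
        simpa using h1 i
  have hinj : Function.Injective (ptsAux d i0) := by
    intro x y hxy
    obtain ⟨α, β, -, h⟩ := key (fun o => o = x)
    have := (h x).2 rfl
    rw [hxy] at this
    exact ((h y).1 this).symm
  let S : Finset (Sph d) := Finset.univ.image (ptsAux d i0)
  have hS : Shatters (sphDiscs d) S := by
    intro T hT
    obtain ⟨α, β, hβ, h⟩ := key (fun o => ptsAux d i0 o ∈ T)
    refine ⟨_, ⟨α, β, hβ, rfl⟩, ?_⟩
    ext x
    constructor
    · rintro ⟨hx, hx'⟩
      obtain ⟨o, -, rfl⟩ := Finset.mem_image.1 (Finset.mem_coe.1 hx)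
      exact (h o).1 hx'
    · intro hx
      have hxS := hT hx
      obtain ⟨o, -, rfl⟩ := Finset.mem_image.1 hxS
      exact ⟨hxS, (h o).2 hx⟩
  have hc : S.card = d + 1 := by
    rw [Finset.card_image_of_injective _ hinj]
    simp
  have : ((S.card : ℕ) : ℕ∞) ≤ VCD (sphDiscs d) :=
    le_iSup₂ (f := fun (S : Finset (Sph d)) (_ : S ∈ {S | Shatters (sphDiscs d) S}) =>
      (S.card : ℕ∞)) S hS
  rw [hc] at this
  exact_mod_cast this
end

section
/- Fix d ≥ 2 and let 𝒜_{d−1} := { {x ∈ S^{d−1} : ⟨x, α⟩ ≥ β} : α ∈ S^{d−1}, β ∈ [−1, 1] } be the collection of discs on S^{d−1}. Then VCD(𝒜_{d−1}) = d + 1. -/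
open scoped symmDiff ENNReal

open scoped RealInnerProductSpace

theorem upper_aux (d : ℕ) (S : Finset (Sph d)) (hS : Shatters (sphDiscs d) S) :
    S.card ≤ d + 1 := by
  classical
  by_contra hcon
  have hna : ¬ AffineIndependent ℝ (fun x : S => ((x : Sph d) : EuclideanSpace ℝ (Fin d))) := by
    intro h
    have h1 := h.card_le_finrank_succ
    have h2 := Submodule.finrank_le
      (vectorSpan ℝ (Set.range (fun x : S => ((x : Sph d) : EuclideanSpace ℝ (Fin d)))))
    rw [finrank_euclideanSpace_fin] at h2
    rw [Fintype.card_coe] at h1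
    omega
  obtain ⟨I, p, hp1, hp2⟩ := Convex.radon_partition hna
  obtain ⟨A, ⟨α, β, hβ, rfl⟩, hA⟩ := hS (S.filter (fun x => ∃ h : x ∈ S, (⟨x, h⟩ : S) ∈ I))
    (Finset.filter_subset _ _)
  have hlin : IsLinearMap ℝ (fun x : EuclideanSpace ℝ (Fin d) =>
      ⟪x, (α : EuclideanSpace ℝ (Fin d))⟫) :=
    ⟨fun x y => inner_add_left _ _ _, fun c x => by
      simp [real_inner_smul_left]⟩
  have hc1 := convex_halfSpace_ge hlin β
  have hc2 := convex_halfSpace_lt hlin β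
  have h1 := convexHull_min (s := (fun x : S => ((x : Sph d) : EuclideanSpace ℝ (Fin d))) '' I)
    (by
      rintro _ ⟨x, hx, rfl⟩
      have : (x : Sph d) ∈ (S : Set (Sph d)) ∩ {x : Sph d |
          β ≤ ⟪(x : EuclideanSpace ℝ (Fin d)), (α : EuclideanSpace ℝ (Fin d))⟫} := by
        rw [hA]
        simp only [Finset.coe_filter, Set.mem_ofPred_eq]
        exact ⟨x.2, x.2, hx⟩
      exact this.2) hc1 hp1
  have h2 := convexHull_min (s := (fun x : S => ((x : Sph d) : EuclideanSpace ℝ (Fin d))) '' Iᶜ)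
    (by
      rintro _ ⟨x, hx, rfl⟩
      by_contra hn
      have : (x : Sph d) ∈ ((S.filter (fun x => ∃ h : x ∈ S, (⟨x, h⟩ : S) ∈ I) :
          Finset (Sph d)) : Set (Sph d)) := by
        rw [← hA]
        exact ⟨x.2, by simpa using hn⟩
      simp only [Finset.coe_filter, Set.mem_ofPred_eq] at this
      obtain ⟨_, h, h'⟩ := this
      exact hx h') hc2 hp2
  simp only [Set.mem_ofPred_eq] at h1 h2
  linarith

theorem lower_aux (d : ℕ) (hd : 2 ≤ d) :
    ∃ S : Finset (Sph d), Shatters (sphDiscs d) S ∧ S.card = d + 1 := by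
  classical
  let i0 : Fin d := ⟨0, by omega⟩
  let i1 : Fin d := ⟨1, by omega⟩
  have h01 : i1 ≠ i0 := by simp [i0, i1]
  let p : Option (Fin d) → Sph d := fun o => match o with
    | none => ⟨-EuclideanSpace.single i0 1, by simp⟩
    | some i => ⟨EuclideanSpace.single i 1, by simp⟩
  have hpn (a : EuclideanSpace ℝ (Fin d)) :
      ⟪((p none : Sph d) : EuclideanSpace ℝ (Fin d)), a⟫ = - a i0 := by
    simp [p, EuclideanSpace.inner_single_left]
  have hps (i : Fin d) (a : EuclideanSpace ℝ (Fin d)) :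
      ⟪((p (some i) : Sph d) : EuclideanSpace ℝ (Fin d)), a⟫ = a i := by
    simp [p, EuclideanSpace.inner_single_left]
  -- every sign pattern is realised by an affine functional
  have key (s : Option (Fin d) → ℝ) : ∃ (a : EuclideanSpace ℝ (Fin d)) (b : ℝ),
      ∀ o, ⟪((p o : Sph d) : EuclideanSpace ℝ (Fin d)), a⟫ - b = s o := by
    refine ⟨WithLp.toLp 2 (fun i => s (some i) - (s (some i0) + s none) / 2),
      - (s (some i0) + s none) / 2, ?_⟩
    rintro (_ | i)
    · rw [hpn]; simp only; ring
    · rw [hps]; simp only; ring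
  have hinj : Function.Injective p := by
    intro o o' h
    by_contra hne
    obtain ⟨a, b, hab⟩ := key (fun x => if x = o then 1 else 0)
    have h1 := hab o
    have h2 := hab o'
    rw [h] at h1
    rw [h1] at h2
    simp [Ne.symm hne] at h2
  refine ⟨Finset.univ.image p, ?_, ?_⟩
  · intro T hT
    have hcoe : ∀ A : Set (Sph d), (∀ o, p o ∈ A ↔ p o ∈ T) →
        ((Finset.univ.image p : Finset (Sph d)) : Set (Sph d)) ∩ A = (T : Set (Sph d)) := by
      intro A hA
      ext x
      constructor
      · rintro ⟨hx, hxA⟩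
        simp only [Finset.coe_image, Finset.coe_univ, Set.image_univ, Set.mem_range] at hx
        obtain ⟨o, rfl⟩ := hx
        exact (hA o).1 hxA
      · intro hx
        have hx' := hT hx
        refine ⟨hx', ?_⟩
        simp only [Finset.mem_image, Finset.mem_univ, true_and] at hx'
        obtain ⟨o, rfl⟩ := hx'
        exact (hA o).2 hx
    by_cases hall : ∀ o, p o ∈ T
    · refine ⟨_, ⟨p none, -1, by simp, rfl⟩, hcoe _ fun o => ?_⟩
      simp only [hall, iff_true, Set.mem_ofPred_eq]
      have := abs_real_inner_le_norm ((p o : Sph d) : EuclideanSpace ℝ (Fin d)) (p none : Sph d)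
      rw [norm_eq_of_mem_sphere, norm_eq_of_mem_sphere, abs_le] at this
      linarith [this.1]
    by_cases hnone : ∀ o, p o ∉ T
    · refine ⟨_, ⟨⟨-EuclideanSpace.single i1 1, by simp⟩, 1, by simp, rfl⟩, hcoe _ fun o => ?_⟩
      simp only [hnone, iff_false, Set.mem_ofPred_eq, not_le]
      rcases o with _ | i
      · rw [hpn]; simp [h01.symm]
      · rw [hps]
        by_cases hi : i = i1
        · subst hi; simp
        · simp [hi]
    push Not at hall hnone
    obtain ⟨o1, ho1⟩ := hall
    obtain ⟨o2, ho2⟩ := hnone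
    obtain ⟨a, b, hab⟩ := key (fun x => if p x ∈ T then 1 else -1)
    have ha : a ≠ 0 := by
      rintro rfl
      have h1 := hab o1
      have h2 := hab o2
      simp only [inner_zero_right, ho1, ho2, if_true, if_false] at h1 h2
      linarith
    have hpos : 0 < ‖a‖ := norm_pos_iff.2 ha
    have hb (o) := abs_real_inner_le_norm ((p o : Sph d) : EuclideanSpace ℝ (Fin d)) a
    simp only [norm_eq_of_mem_sphere, one_mul, abs_le] at hb
    have h1 := hab o1
    have h2 := hab o2
    simp only [ho1, ho2, if_true, if_false] at h1 h2
    refine ⟨_, ⟨⟨‖a‖⁻¹ • a, by simp [norm_smul, hpos.ne']⟩, ‖a‖⁻¹ * b, ⟨?_, ?_⟩, rfl⟩,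
      hcoe _ fun o => ?_⟩
    · rw [inv_mul_eq_div, le_div_iff₀ hpos]; linarith [(hb o1).1]
    · rw [inv_mul_eq_div, div_le_iff₀ hpos]; linarith [(hb o2).2]
    · simp only [Set.mem_ofPred_eq, real_inner_smul_right]
      rw [mul_le_mul_iff_right₀ (inv_pos.2 hpos)]
      have := hab o
      by_cases ho : p o ∈ T
      · simp only [ho, if_true, iff_true] at this ⊢; linarith
      · simp only [ho, if_false, iff_false, not_le] at this ⊢; linarith
  · rw [Finset.card_image_of_injective _ hinj]; simp

/-- Lemma: the collection of discs on `S^{d-1}` has VC dimension exactly `d + 1`. -/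
theorem statement15 (d : ℕ) (hd : 2 ≤ d) :
    VCD (sphDiscs d) = (d : ℕ∞) + 1 := by
  apply le_antisymm
  · refine iSup₂_le fun S hS => ?_
    exact_mod_cast upper_aux d S hS
  · obtain ⟨S, hS, hc⟩ := lower_aux d hd
    have := le_iSup₂ (f := fun (S : Finset (Sph d))
      (_ : S ∈ {S : Finset (Sph d) | Shatters (sphDiscs d) S}) => (S.card : ℕ∞)) S hS
    simp only [hc] at this
    exact_mod_cast this
end
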